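/- arXiv:2301.10806 — 2 statements merged into one kernel-verified Lean document; each statement's English description precedes it below -/
import Mathlib

section
/- Let μ ∈ 𝒥_n be nonzero. Then: (a) the orbit SL(n,ℂ)·μ is closed in V_n if and only if the trace form τ_μ is nondegenerate (i.e., μ is a semisimple Jordan algebra); and (b) if τ_μ is degenerate, then 0 lies in the closure of SL(n,ℂ)·μ in V_n. -/
open Matrix

noncomputable section

/-- `Vn n` is the space of `n`-dimensional commutative complex algebras, i.e. symmetric
ℂ-bilinear maps `ℂⁿ × ℂⁿ → ℂⁿ`, encoded by structure constants with respect to the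
standard basis: `μ i j k` is the `e k`-coordinate of `μ(e i, e j)`. -/
abbrev Vn (n : ℕ) : Type := Fin n → Fin n → Fin n → ℂ

namespace Vn

variable {n : ℕ}

/-- symmetry (commutativity) of the multiplication -/
def IsSymm (μ : Vn n) : Prop := ∀ i j k, μ i j k = μ j i k

/-- the product `μ(x, y)` -/
def mul (μ : Vn n) (x y : Fin n → ℂ) : Fin n → ℂ :=
  fun k => ∑ i, ∑ j, x i * y j * μ i j k

/-- left multiplication `L^μ_x`, as a matrix -/
def L (μ : Vn n) (x : Fin n → ℂ) : Matrix (Fin n) (Fin n) ℂ :=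
  Matrix.of fun k j => ∑ i, x i * μ i j k

/-- the standard Hermitian inner product on `ℂⁿ` (linear in the first variable) -/
def herm (x y : Fin n → ℂ) : ℂ := ∑ i, x i * star (y i)

/-- the moment matrix `M_μ = -2 ∑ᵢ (L_{xᵢ})* L_{xᵢ} + ∑ᵢ L_{xᵢ} (L_{xᵢ})*`,
computed with respect to the standard orthonormal basis of `ℂⁿ` -/
def Mmat (μ : Vn n) : Matrix (Fin n) (Fin n) ℂ :=
  (-2 : ℂ) • ∑ i, (L μ (Pi.single i 1))ᴴ * L μ (Pi.single i 1)
    + ∑ i, L μ (Pi.single i 1) * (L μ (Pi.single i 1))ᴴ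

/-- the Hermitian product on `Vn n` -/
def innerV (μ ν : Vn n) : ℂ := ∑ i, ∑ j, ∑ k, μ i j k * star (ν i j k)

/-- the squared norm `‖μ‖²` on `Vn n` -/
def normSqV (μ : Vn n) : ℝ := ∑ i, ∑ j, ∑ k, Complex.normSq (μ i j k)

/-- the infinitesimal change-of-basis action of `gl(n, ℂ)` on `Vn n`:
`(A·μ)(x,y) = A(μ(x,y)) - μ(Ax,y) - μ(x,Ay)` -/
def glAct (A : Matrix (Fin n) (Fin n) ℂ) (μ : Vn n) : Vn n :=
  fun i j k =>
    (A *ᵥ mul μ (Pi.single i 1) (Pi.single j 1)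
      - mul μ (A *ᵥ Pi.single i 1) (Pi.single j 1)
      - mul μ (Pi.single i 1) (A *ᵥ Pi.single j 1)) k

/-- the change-of-basis action of `GL(n, ℂ)` on `Vn n`:
`(g·μ)(x,y) = g(μ(g⁻¹x, g⁻¹y))` -/
def gAct (g : GL (Fin n) ℂ) (μ : Vn n) : Vn n :=
  fun i j k =>
    ((g : Matrix (Fin n) (Fin n) ℂ) *ᵥ
      mul μ ((↑g⁻¹ : Matrix (Fin n) (Fin n) ℂ) *ᵥ Pi.single i 1)
            ((↑g⁻¹ : Matrix (Fin n) (Fin n) ℂ) *ᵥ Pi.single j 1)) k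

/-- the `GL(n,ℂ)`-orbit (isomorphism class) of `μ` -/
def orbit (μ : Vn n) : Set (Vn n) := { ν | ∃ g : GL (Fin n) ℂ, ν = gAct g μ }

/-- `D` is a derivation of `μ` -/
def IsDeriv (μ : Vn n) (D : Matrix (Fin n) (Fin n) ℂ) : Prop :=
  ∀ x y, D *ᵥ mul μ x y = mul μ (D *ᵥ x) y + mul μ x (D *ᵥ y)

/-- the associator `(a,b,c) = (ab)c - a(bc)` -/
def assoc (μ : Vn n) (a b c : Fin n → ℂ) : Fin n → ℂ :=
  mul μ (mul μ a b) c - mul μ a (mul μ b c)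

/-- `μ` is a Jordan algebra: commutative and satisfying the linearized Jordan identity
`(ab,c,d) + (bd,c,a) + (da,c,b) = 0` -/
def IsJordan (μ : Vn n) : Prop :=
  IsSymm μ ∧ ∀ a b c d : Fin n → ℂ,
    assoc μ (mul μ a b) c d + assoc μ (mul μ b d) c a + assoc μ (mul μ d a) c b = 0

/-- `μ` is a soliton: `μ ≠ 0` and `M_μ · μ ∈ ℝ μ` -/
def IsSoliton (μ : Vn n) : Prop :=
  μ ≠ 0 ∧ ∃ c : ℝ, glAct (Mmat μ) μ = (c : ℂ) • μ

/-- the constant `c_μ = -Tr(M_μ²)/‖μ‖²` -/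
def cconst (μ : Vn n) : ℝ := -(Matrix.trace (Mmat μ * Mmat μ)).re / normSqV μ

/-- `D_μ = M_μ - c_μ • I` -/
def Dmat (μ : Vn n) : Matrix (Fin n) (Fin n) ℂ := Mmat μ - (cconst μ : ℂ) • 1

/-- the energy `E_n(μ) = Tr(M_μ²)/‖μ‖⁴` -/
def energy (μ : Vn n) : ℝ := (Matrix.trace (Mmat μ * Mmat μ)).re / (normSqV μ) ^ 2

/-- the trace form `τ_μ(x, y) = Tr L_{μ(x,y)}` -/
def traceForm (μ : Vn n) (x y : Fin n → ℂ) : ℂ := Matrix.trace (L μ (mul μ x y))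

/-- nondegeneracy of the trace form (Albert's criterion for semisimplicity) -/
def TraceFormNondeg (μ : Vn n) : Prop := ∀ x, (∀ y, traceForm μ x y = 0) → x = 0

end Vn


/-- the change-of-basis action of `SL(n,ℂ)` on `Vn n` -/
def slAct {n : ℕ} (g : Matrix.SpecialLinearGroup (Fin n) ℂ) (μ : Vn n) : Vn n :=
  fun i j k =>
    ((g : Matrix (Fin n) (Fin n) ℂ) *ᵥ
      Vn.mul μ ((↑g⁻¹ : Matrix (Fin n) (Fin n) ℂ) *ᵥ Pi.single i 1)
               ((↑g⁻¹ : Matrix (Fin n) (Fin n) ℂ) *ᵥ Pi.single j 1)) k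

/-- the `SL(n,ℂ)`-orbit of `μ` -/
def slOrbit {n : ℕ} (μ : Vn n) : Set (Vn n) :=
  { ν | ∃ g : Matrix.SpecialLinearGroup (Fin n) ℂ, ν = slAct g μ }

namespace Vn

variable {n : ℕ}

/-! ### Trilinear changes of basis -/

/-- the tensor of the bilinear map `(x, y) ↦ X(μ(Yx, Zy))` -/
def tri (X Y Z : Matrix (Fin n) (Fin n) ℂ) (μ : Vn n) : Vn n :=
  fun i j k => (X *ᵥ mul μ (Y *ᵥ Pi.single i 1) (Z *ᵥ Pi.single j 1)) k

lemma tri_apply (X Y Z : Matrix (Fin n) (Fin n) ℂ) (μ : Vn n) (i j k : Fin n) :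
    tri X Y Z μ i j k = ∑ c, ∑ a, ∑ b, X k c * Y a i * Z b j * μ a b c := by
  simp only [tri, mulVec, dotProduct, mul, Pi.single_apply, mul_ite, mul_one, mul_zero,
    Finset.sum_ite_eq', Finset.mem_univ, if_true, Finset.mul_sum, mul_assoc]

lemma L_mulVec (μ : Vn n) (x y : Fin n → ℂ) : L μ x *ᵥ y = mul μ x y := by
  ext k
  simp only [L, mulVec, dotProduct, mul, of_apply, Finset.sum_mul]
  rw [Finset.sum_comm]
  exact Finset.sum_congr rfl fun i _ => Finset.sum_congr rfl fun j _ => by ring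

lemma mul_add_right (μ : Vn n) (x y z : Fin n → ℂ) : mul μ x (y + z) = mul μ x y + mul μ x z := by
  simp only [← L_mulVec, mulVec_add]

lemma mul_smul_right (μ : Vn n) (c : ℂ) (x y : Fin n → ℂ) : mul μ x (c • y) = c • mul μ x y := by
  simp only [← L_mulVec, mulVec_smul]

lemma mul_add_left (μ : Vn n) (x y z : Fin n → ℂ) : mul μ (x + y) z = mul μ x z + mul μ y z := by
  ext k
  simp [mul, add_mul, Finset.sum_add_distrib]

lemma mul_smul_left (μ : Vn n) (c : ℂ) (x y : Fin n → ℂ) : mul μ (c • x) y = c • mul μ x y := by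
  ext k
  simp [mul, Finset.mul_sum, mul_assoc]

lemma mul_single_single (μ : Vn n) (i j : Fin n) :
    mul μ (Pi.single i 1) (Pi.single j 1) = μ i j := by
  ext k
  simp [mul, Pi.single_apply]

/-- the product as a bilinear map -/
def mulB (μ : Vn n) : (Fin n → ℂ) →ₗ[ℂ] (Fin n → ℂ) →ₗ[ℂ] (Fin n → ℂ) :=
  LinearMap.mk₂ ℂ (mul μ) (mul_add_left μ) (mul_smul_left μ) (mul_add_right μ) (mul_smul_right μ)

@[simp] lemma mulB_apply (μ : Vn n) (x y : Fin n → ℂ) : mulB μ x y = mul μ x y := rfl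

lemma ext_mul {μ ν : Vn n} (h : ∀ x y, mul μ x y = mul ν x y) : μ = ν := by
  ext i j k
  rw [← mul_single_single μ, ← mul_single_single ν, h]

lemma mul_ext_single {B C : (Fin n → ℂ) →ₗ[ℂ] (Fin n → ℂ) →ₗ[ℂ] (Fin n → ℂ)}
    (h : ∀ i j, B (Pi.single i 1) (Pi.single j 1) = C (Pi.single i 1) (Pi.single j 1)) : B = C := by
  refine (Pi.basisFun ℂ (Fin n)).ext fun i => (Pi.basisFun ℂ (Fin n)).ext fun j => ?_
  simpa using h i j

lemma mul_tri (X Y Z : Matrix (Fin n) (Fin n) ℂ) (μ : Vn n) (x y : Fin n → ℂ) :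
    mul (tri X Y Z μ) x y = X *ᵥ mul μ (Y *ᵥ x) (Z *ᵥ y) := by
  have : mulB (tri X Y Z μ) =
      ((mulB μ).compl₁₂ (Matrix.mulVecLin Y) (Matrix.mulVecLin Z)).compr₂ (Matrix.mulVecLin X) := by
    refine mul_ext_single fun i j => ?_
    simp only [mulB_apply, mul_single_single, LinearMap.compr₂_apply, LinearMap.compl₁₂_apply,
      Matrix.mulVecLin_apply]
    rfl
  simpa using LinearMap.congr_fun₂ this x y

lemma tri_tri (X Y Z X' Y' Z' : Matrix (Fin n) (Fin n) ℂ) (μ : Vn n) :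
    tri X Y Z (tri X' Y' Z' μ) = tri (X * X') (Y' * Y) (Z' * Z) μ := by
  refine ext_mul fun x y => ?_
  simp [mul_tri, mulVec_mulVec]

@[simp] lemma tri_one (μ : Vn n) : tri 1 1 1 μ = μ :=
  ext_mul fun x y => by simp [mul_tri]

lemma mul_add_apply (μ ν : Vn n) (x y : Fin n → ℂ) : mul (μ + ν) x y = mul μ x y + mul ν x y := by
  ext k
  simp [mul, mul_add, Finset.sum_add_distrib]

lemma mul_sub_apply (μ ν : Vn n) (x y : Fin n → ℂ) : mul (μ - ν) x y = mul μ x y - mul ν x y := by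
  ext k
  simp [mul, mul_sub, Finset.sum_sub_distrib]

lemma mul_sub_left (μ : Vn n) (x y z : Fin n → ℂ) : mul μ (x - y) z = mul μ x z - mul μ y z := by
  simp only [← mulB_apply, map_sub, LinearMap.sub_apply]

lemma mul_sub_right (μ : Vn n) (x y z : Fin n → ℂ) :
    mul μ x (y - z) = mul μ x y - mul μ x z := by
  simp only [← mulB_apply, map_sub]

lemma mul_zero_left (μ : Vn n) (x : Fin n → ℂ) : mul μ 0 x = 0 := by
  ext k
  simp [mul]

lemma mul_zero_tensor (x y : Fin n → ℂ) : mul (0 : Vn n) x y = 0 := by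
  ext k
  simp [mul]

lemma tri_sub (X Y Z : Matrix (Fin n) (Fin n) ℂ) (μ ν : Vn n) :
    tri X Y Z (μ - ν) = tri X Y Z μ - tri X Y Z ν :=
  ext_mul fun x y => by simp [mul_tri, mul_sub_apply, mulVec_sub]

lemma tri_zero (X Y Z : Matrix (Fin n) (Fin n) ℂ) : tri X Y Z (0 : Vn n) = 0 :=
  ext_mul fun x y => by simp [mul_tri, mul_zero_tensor]

lemma glAct_eq_tri (A : Matrix (Fin n) (Fin n) ℂ) (μ : Vn n) :
    glAct A μ = tri A 1 1 μ - tri 1 A 1 μ - tri 1 1 A μ := by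
  ext i j k
  simp only [glAct, tri, one_mulVec, Pi.sub_apply]

lemma mul_glAct (A : Matrix (Fin n) (Fin n) ℂ) (μ : Vn n) (x y : Fin n → ℂ) :
    mul (glAct A μ) x y = A *ᵥ mul μ x y - mul μ (A *ᵥ x) y - mul μ x (A *ᵥ y) := by
  simp [glAct_eq_tri, mul_sub_apply, mul_tri]

lemma glAct_eq_zero_iff {A : Matrix (Fin n) (Fin n) ℂ} {μ : Vn n} :
    glAct A μ = 0 ↔ IsDeriv μ A := by
  constructor
  · intro h x y
    have := mul_glAct A μ x y
    rw [h, mul_zero_tensor, sub_sub, eq_comm, sub_eq_zero] at this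
    exact this
  · intro h
    refine ext_mul fun x y => ?_
    rw [mul_glAct, h x y, mul_zero_tensor]
    abel

lemma slAct_eq_tri (g : Matrix.SpecialLinearGroup (Fin n) ℂ) (μ : Vn n) :
    slAct g μ = tri (g : Matrix (Fin n) (Fin n) ℂ) (↑g⁻¹ : Matrix (Fin n) (Fin n) ℂ)
      (↑g⁻¹ : Matrix (Fin n) (Fin n) ℂ) μ := rfl

lemma sl_mul_inv (g : Matrix.SpecialLinearGroup (Fin n) ℂ) :
    (g : Matrix (Fin n) (Fin n) ℂ) * (↑g⁻¹ : Matrix (Fin n) (Fin n) ℂ) = 1 := by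
  rw [← Matrix.SpecialLinearGroup.coe_mul, mul_inv_cancel, Matrix.SpecialLinearGroup.coe_one]

lemma sl_inv_mul (g : Matrix.SpecialLinearGroup (Fin n) ℂ) :
    (↑g⁻¹ : Matrix (Fin n) (Fin n) ℂ) * (g : Matrix (Fin n) (Fin n) ℂ) = 1 := by
  rw [← Matrix.SpecialLinearGroup.coe_mul, inv_mul_cancel, Matrix.SpecialLinearGroup.coe_one]

lemma slAct_slAct (g h : Matrix.SpecialLinearGroup (Fin n) ℂ) (μ : Vn n) :
    slAct g (slAct h μ) = slAct (g * h) μ := by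
  simp only [slAct_eq_tri, tri_tri, _root_.mul_inv_rev, Matrix.SpecialLinearGroup.coe_mul]

lemma slAct_one (μ : Vn n) : slAct 1 μ = μ := by
  simp [slAct_eq_tri]

lemma slAct_zero (g : Matrix.SpecialLinearGroup (Fin n) ℂ) : slAct g (0 : Vn n) = 0 := by
  rw [slAct_eq_tri, tri_zero]

lemma mem_slOrbit_self (μ : Vn n) : μ ∈ slOrbit μ := ⟨1, (slAct_one μ).symm⟩

lemma slAct_mem_slOrbit {μ ν : Vn n} (g : Matrix.SpecialLinearGroup (Fin n) ℂ)
    (h : ν ∈ slOrbit μ) : slAct g ν ∈ slOrbit μ := by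
  obtain ⟨k, rfl⟩ := h
  exact ⟨g * k, slAct_slAct g k μ⟩

lemma slOrbit_symm {μ ν : Vn n} (h : ν ∈ slOrbit μ) : μ ∈ slOrbit ν := by
  obtain ⟨k, rfl⟩ := h
  exact ⟨k⁻¹, by rw [slAct_slAct, inv_mul_cancel, slAct_one]⟩

lemma slOrbit_trans {μ ν ω : Vn n} (h : ν ∈ slOrbit μ) (h' : ω ∈ slOrbit ν) : ω ∈ slOrbit μ := by
  obtain ⟨k, rfl⟩ := h'
  exact slAct_mem_slOrbit k h

lemma mem_slOrbit_of_det {μ ν : Vn n} (g : Matrix (Fin n) (Fin n) ℂ) (hg : g.det = 1)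
    (h : ∀ x y, g *ᵥ mul ν x y = mul μ (g *ᵥ x) (g *ᵥ y)) : μ ∈ slOrbit ν := by
  obtain ⟨G, rfl⟩ : ∃ G : Matrix.SpecialLinearGroup (Fin n) ℂ,
    (G : Matrix (Fin n) (Fin n) ℂ) = g := ⟨⟨g, hg⟩, rfl⟩
  refine ⟨G, ext_mul fun x y => ?_⟩
  rw [slAct_eq_tri, mul_tri, h, mulVec_mulVec, mulVec_mulVec, sl_mul_inv, one_mulVec, one_mulVec]

lemma continuous_tri : Continuous fun p : Matrix (Fin n) (Fin n) ℂ × Matrix (Fin n) (Fin n) ℂ ×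
    Matrix (Fin n) (Fin n) ℂ × Vn n => tri p.1 p.2.1 p.2.2.1 p.2.2.2 := by
  refine continuous_pi fun i => continuous_pi fun j => continuous_pi fun k => ?_
  simp only [tri_apply]
  fun_prop

lemma continuous_mul : Continuous fun p : Vn n × (Fin n → ℂ) × (Fin n → ℂ) =>
    mul p.1 p.2.1 p.2.2 := by
  unfold mul
  fun_prop

lemma continuous_L : Continuous fun p : Vn n × (Fin n → ℂ) => L p.1 p.2 := by
  unfold L
  refine continuous_pi fun i => continuous_pi fun j => ?_
  simp only [of_apply]
  fun_prop

lemma continuous_slAct (g : Matrix.SpecialLinearGroup (Fin n) ℂ) :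
    Continuous (slAct g : Vn n → Vn n) := by
  have : (slAct g : Vn n → Vn n) = fun μ => tri (g : Matrix (Fin n) (Fin n) ℂ)
    (↑g⁻¹ : Matrix (Fin n) (Fin n) ℂ) (↑g⁻¹ : Matrix (Fin n) (Fin n) ℂ) μ := rfl
  rw [this]
  exact continuous_tri.comp (by fun_prop : Continuous fun μ : Vn n =>
    ((g : Matrix (Fin n) (Fin n) ℂ), (↑g⁻¹ : Matrix (Fin n) (Fin n) ℂ),
      (↑g⁻¹ : Matrix (Fin n) (Fin n) ℂ), μ))

lemma slAct_mem_closure {μ ν : Vn n} (g : Matrix.SpecialLinearGroup (Fin n) ℂ)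
    (h : ν ∈ closure (slOrbit μ)) : slAct g ν ∈ closure (slOrbit μ) :=
  map_mem_closure (continuous_slAct g) h fun _ => slAct_mem_slOrbit g

lemma closure_slOrbit_subset {μ ν : Vn n} (h : ν ∈ closure (slOrbit μ)) :
    closure (slOrbit ν) ⊆ closure (slOrbit μ) := by
  refine closure_minimal ?_ isClosed_closure
  rintro _ ⟨g, rfl⟩
  exact slAct_mem_closure g h

/-! ### The Hermitian product -/

lemma innerV_tri (X Y Z : Matrix (Fin n) (Fin n) ℂ) (μ ν : Vn n) :
    innerV (tri X Y Z μ) ν = innerV μ (tri Xᴴ Yᴴ Zᴴ ν) := by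
  simp only [innerV, tri_apply, star_sum, star_mul', conjTranspose_apply, star_star,
    Finset.sum_mul, Finset.mul_sum]
  simp only [← Fintype.sum_prod_type']
  let e : Fin n × Fin n × Fin n × Fin n × Fin n × Fin n →
      Fin n × Fin n × Fin n × Fin n × Fin n × Fin n :=
    fun p => (p.2.2.2.2.1, p.2.2.2.2.2, p.2.2.2.1, p.2.2.1, p.1, p.2.1)
  have he : Function.Bijective e := Function.Involutive.bijective fun _ => rfl
  refine Fintype.sum_bijective e he _ _ ?_
  rintro ⟨i, j, k, c, a, b⟩
  simp only [e]
  ring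

lemma innerV_sub_left (μ ν ω : Vn n) : innerV (μ - ν) ω = innerV μ ω - innerV ν ω := by
  simp [innerV, sub_mul, Finset.sum_sub_distrib]

lemma innerV_sub_right (μ ν ω : Vn n) : innerV μ (ν - ω) = innerV μ ν - innerV μ ω := by
  simp [innerV, mul_sub, Finset.sum_sub_distrib]

lemma innerV_self (μ : Vn n) : innerV μ μ = (normSqV μ : ℂ) := by
  simp [innerV, normSqV, Complex.mul_conj]

lemma normSqV_nonneg (μ : Vn n) : 0 ≤ normSqV μ :=
  Finset.sum_nonneg fun _ _ => Finset.sum_nonneg fun _ _ => Finset.sum_nonneg fun _ _ =>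
    Complex.normSq_nonneg _

lemma normSq_le_normSqV (μ : Vn n) (i j k : Fin n) : Complex.normSq (μ i j k) ≤ normSqV μ := by
  have h1 : Complex.normSq (μ i j k) ≤ ∑ k, Complex.normSq (μ i j k) :=
    Finset.single_le_sum (f := fun k => Complex.normSq (μ i j k))
      (fun _ _ => Complex.normSq_nonneg _) (Finset.mem_univ k)
  have h2 : ∑ k, Complex.normSq (μ i j k) ≤ ∑ j, ∑ k, Complex.normSq (μ i j k) :=
    Finset.single_le_sum (f := fun j => ∑ k, Complex.normSq (μ i j k))
      (fun _ _ => Finset.sum_nonneg fun _ _ => Complex.normSq_nonneg _) (Finset.mem_univ j)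
  have h3 : ∑ j, ∑ k, Complex.normSq (μ i j k) ≤ normSqV μ :=
    Finset.single_le_sum (f := fun i => ∑ j, ∑ k, Complex.normSq (μ i j k))
      (fun _ _ => Finset.sum_nonneg fun _ _ => Finset.sum_nonneg fun _ _ =>
        Complex.normSq_nonneg _) (Finset.mem_univ i)
  exact h1.trans (h2.trans h3)

lemma eq_zero_of_normSqV {μ : Vn n} (h : normSqV μ = 0) : μ = 0 := by
  ext i j k
  have := normSq_le_normSqV μ i j k
  rw [h] at this
  exact Complex.normSq_eq_zero.mp (le_antisymm this (Complex.normSq_nonneg _))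

lemma innerV_glAct (A : Matrix (Fin n) (Fin n) ℂ) (μ ν : Vn n) :
    innerV (glAct A μ) ν = innerV μ (glAct Aᴴ ν) := by
  simp only [glAct_eq_tri, innerV_sub_left, innerV_sub_right, innerV_tri, conjTranspose_one]

lemma glAct_mul_sub (A B : Matrix (Fin n) (Fin n) ℂ) (μ : Vn n) :
    glAct (A * B - B * A) μ = glAct A (glAct B μ) - glAct B (glAct A μ) := by
  refine ext_mul fun x y => ?_
  simp only [mul_sub_apply, mul_glAct, sub_mulVec, ← mulVec_mulVec, mulVec_sub,
    mul_sub_left, mul_sub_right]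
  abel

lemma glAct_sub_left (A B : Matrix (Fin n) (Fin n) ℂ) (μ : Vn n) :
    glAct (A - B) μ = glAct A μ - glAct B μ := by
  refine ext_mul fun x y => ?_
  simp only [mul_sub_apply, mul_glAct, sub_mulVec, mul_sub_left, mul_sub_right]
  abel

lemma glAct_smul_one (c : ℂ) (μ : Vn n) :
    glAct (c • (1 : Matrix (Fin n) (Fin n) ℂ)) μ = -(c • μ) := by
  ext i j k
  simp only [glAct, smul_mulVec, one_mulVec, mul_smul_left, mul_smul_right, mul_single_single]
  simp

/-! ### One-parameter subgroups -/

/-- the one-parameter group `t ↦ exp(tA)` -/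
def matExp (A : Matrix (Fin n) (Fin n) ℂ) (t : ℝ) : Matrix (Fin n) (Fin n) ℂ :=
  NormedSpace.exp (t • A)

lemma matExp_zero (A : Matrix (Fin n) (Fin n) ℂ) : matExp A 0 = 1 := by
  simp [matExp]

lemma matExp_add (A : Matrix (Fin n) (Fin n) ℂ) (s t : ℝ) :
    matExp A (s + t) = matExp A s * matExp A t := by
  simp only [matExp, add_smul]
  exact Matrix.exp_add_of_commute _ _ (((Commute.refl A).smul_left s).smul_right t)

lemma matExp_neg_mul (A : Matrix (Fin n) (Fin n) ℂ) (t : ℝ) : matExp A (-t) * matExp A t = 1 := by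
  rw [← matExp_add, neg_add_cancel, matExp_zero]

section
attribute [local instance] Matrix.linftyOpNormedRing Matrix.linftyOpNormedAlgebra

lemma hasDerivAt_matExp (A : Matrix (Fin n) (Fin n) ℂ) (t : ℝ) (i j : Fin n) :
    HasDerivAt (fun t => matExp A t i j) ((matExp A t * A) i j) t := by
  have h := hasDerivAt_exp_smul_const (𝕂 := ℝ) A t
  have h1 := hasDerivAt_pi.mp h i
  exact hasDerivAt_pi.mp h1 j

lemma hasDerivAt_matExp' (A : Matrix (Fin n) (Fin n) ℂ) (t : ℝ) (i j : Fin n) :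
    HasDerivAt (fun t => matExp A t i j) ((A * matExp A t) i j) t := by
  have h := hasDerivAt_exp_smul_const' (𝕂 := ℝ) A t
  have h1 := hasDerivAt_pi.mp h i
  exact hasDerivAt_pi.mp h1 j

end

lemma hasDerivAt_matExp_neg (A : Matrix (Fin n) (Fin n) ℂ) (t : ℝ) (i j : Fin n) :
    HasDerivAt (fun t => matExp A (-t) i j) (-(A * matExp A (-t)) i j) t := by
  have := (hasDerivAt_matExp' A (-t) i j).scomp t (hasDerivAt_neg t)
  simpa [Function.comp_def] using this

lemma hasDerivAt_det_matExp_zero (A : Matrix (Fin n) (Fin n) ℂ) :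
    HasDerivAt (fun t => (matExp A t).det) A.trace 0 := by
  have h : ∀ σ : Equiv.Perm (Fin n), HasDerivAt (fun t => ∏ i, matExp A t (σ i) i)
      (∑ i, (∏ j ∈ Finset.univ.erase i, matExp A 0 (σ j) j) • (matExp A 0 * A) (σ i) i) 0 :=
    fun σ => HasDerivAt.fun_finsetProd fun i _ => hasDerivAt_matExp A 0 (σ i) i
  have h2 := HasDerivAt.fun_sum (u := Finset.univ) fun σ _ =>
    (h σ).const_smul (Equiv.Perm.sign σ)
  have e : (fun t => (matExp A t).det) =
      fun t => ∑ σ : Equiv.Perm (Fin n), Equiv.Perm.sign σ • ∏ i, matExp A t (σ i) i := by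
    ext t
    exact Matrix.det_apply _
  rw [e]
  convert! h2 using 1
  rw [Finset.sum_eq_single 1]
  · simp [matExp_zero, trace]
  · intro σ _ hσ
    rw [Finset.sum_eq_zero, smul_zero]
    intro i _
    obtain ⟨j, hji, hj⟩ : ∃ j, j ≠ i ∧ σ j ≠ j := by
      by_contra! hc
      refine hσ (Equiv.ext fun k => ?_)
      by_cases hk : k = i
      · subst hk
        by_contra hne
        have h1 := hc _ hne
        exact hne (σ.injective h1)
      · exact hc k hk
    rw [Finset.prod_eq_zero (i := j) (by simp [hji]), zero_smul]
    rw [matExp_zero, one_apply_ne hj]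
  · simp

lemma det_matExp {A : Matrix (Fin n) (Fin n) ℂ} (hA : A.trace = 0) (t : ℝ) :
    (matExp A t).det = 1 := by
  have h : ∀ t, HasDerivAt (fun t => (matExp A t).det) 0 t := by
    intro t
    have h0 := hasDerivAt_det_matExp_zero A
    rw [hA] at h0
    have h1 : HasDerivAt (fun s => (matExp A (s - t)).det) 0 t := by
      have h0' : HasDerivAt (fun t => (matExp A t).det) 0 (t - t) := by rwa [sub_self]
      have h2 : HasDerivAt (fun s : ℝ => s - t) 1 t := (hasDerivAt_id t).sub_const t
      simpa [Function.comp_def] using HasDerivAt.scomp (h := fun s : ℝ => s - t) t h0' h2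
    have h2 := h1.const_mul (matExp A t).det
    simp only [mul_zero] at h2
    refine h2.congr_of_eventuallyEq (Filter.Eventually.of_forall fun s => ?_)
    simp only
    rw [← det_mul, ← matExp_add, add_sub_cancel]
  have := is_const_of_deriv_eq_zero (fun t => (h t).differentiableAt) (fun t => (h t).deriv) t 0
  simpa [matExp_zero] using this

lemma hasDerivAt_tri {X Y Z : ℝ → Matrix (Fin n) (Fin n) ℂ} {X' Y' Z' : Matrix (Fin n) (Fin n) ℂ}
    {t : ℝ} (hX : ∀ i j, HasDerivAt (fun t => X t i j) (X' i j) t)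
    (hY : ∀ i j, HasDerivAt (fun t => Y t i j) (Y' i j) t)
    (hZ : ∀ i j, HasDerivAt (fun t => Z t i j) (Z' i j) t) (μ : Vn n) (i j k : Fin n) :
    HasDerivAt (fun t => tri (X t) (Y t) (Z t) μ i j k)
      ((tri X' (Y t) (Z t) μ + tri (X t) Y' (Z t) μ + tri (X t) (Y t) Z' μ) i j k) t := by
  have : HasDerivAt (fun t => ∑ c, ∑ a, ∑ b, X t k c * Y t a i * Z t b j * μ a b c)
      (∑ c, ∑ a, ∑ b, ((X' k c * Y t a i + X t k c * Y' a i) * Z t b j +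
        X t k c * Y t a i * Z' b j) * μ a b c) t :=
    HasDerivAt.fun_sum fun c _ => HasDerivAt.fun_sum fun a _ => HasDerivAt.fun_sum fun b _ =>
      (((hX k c).mul (hY a i)).mul (hZ b j)).mul_const _
  simp only [Pi.add_apply, tri_apply]
  convert! this using 1
  simp only [← Finset.sum_add_distrib]
  refine Finset.sum_congr rfl fun c _ => Finset.sum_congr rfl fun a _ =>
    Finset.sum_congr rfl fun b _ => ?_
  ring

/-- the curve `t ↦ exp(tA)·μ` -/
def flow (A : Matrix (Fin n) (Fin n) ℂ) (μ : Vn n) (t : ℝ) : Vn n :=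
  tri (matExp A t) (matExp A (-t)) (matExp A (-t)) μ

lemma flow_zero (A : Matrix (Fin n) (Fin n) ℂ) (μ : Vn n) : flow A μ 0 = μ := by
  simp [flow, matExp_zero]

lemma hasDerivAt_flow (A : Matrix (Fin n) (Fin n) ℂ) (μ : Vn n) (t : ℝ) (i j k : Fin n) :
    HasDerivAt (fun t => flow A μ t i j k) (flow A (glAct A μ) t i j k) t := by
  have h := hasDerivAt_tri (X := matExp A) (Y := fun t => matExp A (-t))
    (Z := fun t => matExp A (-t)) (X' := matExp A t * A) (Y' := -(A * matExp A (-t)))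
    (Z' := -(A * matExp A (-t))) (t := t) (hasDerivAt_matExp A t) (hasDerivAt_matExp_neg A t)
    (hasDerivAt_matExp_neg A t) μ i j k
  convert! h using 1
  refine congrFun (congrFun (congrFun (ext_mul fun x y => ?_) i) j) k
  simp only [flow, mul_tri, mul_add_apply, mul_glAct, ← mulVec_mulVec, neg_mulVec, mulVec_sub]
  simp only [← mulB_apply, map_neg, LinearMap.neg_apply, mulVec_neg]
  abel

lemma flow_mem_slOrbit {A : Matrix (Fin n) (Fin n) ℂ} (hA : A.trace = 0) (μ : Vn n) (t : ℝ) :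
    flow A μ t ∈ slOrbit μ := by
  refine mem_slOrbit_of_det (matExp A t) (det_matExp hA t) fun x y => ?_
  simp only [flow, mul_tri, mulVec_mulVec, matExp_neg_mul, one_mulVec]

lemma flow_eq_of_isDeriv {A : Matrix (Fin n) (Fin n) ℂ} {μ : Vn n} (h : IsDeriv μ A) (t : ℝ) :
    flow A μ t = μ := by
  ext i j k
  have hd : ∀ t, HasDerivAt (fun t => flow A μ t i j k) 0 t := fun t => by
    have := hasDerivAt_flow A μ t i j k
    rw [glAct_eq_zero_iff.mpr h] at this
    simpa [flow, tri_zero] using this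
  have := is_const_of_deriv_eq_zero (fun t => (hd t).differentiableAt) (fun t => (hd t).deriv) t 0
  simpa [flow_zero] using this

lemma hasDerivAt_normSq {f : ℝ → ℂ} {f' : ℂ} {t : ℝ} (h : HasDerivAt f f' t) :
    HasDerivAt (fun t => Complex.normSq (f t)) (2 * (f' * star (f t)).re) t := by
  have hre : HasDerivAt (fun t => (f t).re) f'.re t :=
    (Complex.reCLM.hasFDerivAt.comp_hasDerivAt t h)
  have him : HasDerivAt (fun t => (f t).im) f'.im t :=
    (Complex.imCLM.hasFDerivAt.comp_hasDerivAt t h)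
  have := (hre.mul hre).add (him.mul him)
  simp only [Complex.normSq_apply]
  convert! this using 1
  simp [Complex.mul_re]
  ring

/-- `ν` is a critical point of the norm along its `SL`-orbit -/
def IsCritical (ν : Vn n) : Prop :=
  ∀ A : Matrix (Fin n) (Fin n) ℂ, A.trace = 0 → (innerV (glAct A ν) ν).re = 0

lemma hasDerivAt_normSqV_flow (A : Matrix (Fin n) (Fin n) ℂ) (ν : Vn n) :
    HasDerivAt (fun t => normSqV (flow A ν t)) (2 * (innerV (glAct A ν) ν).re) 0 := by
  have h := HasDerivAt.fun_sum (u := Finset.univ) fun i _ =>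
    HasDerivAt.fun_sum (u := Finset.univ) fun j _ =>
    HasDerivAt.fun_sum (u := Finset.univ) fun k _ => hasDerivAt_normSq (hasDerivAt_flow A ν 0 i j k)
  convert! h using 1
  simp only [innerV, flow_zero, Complex.re_sum, Finset.mul_sum]

lemma isCritical_of_forall_le {ν : Vn n} (h : ∀ ω ∈ slOrbit ν, normSqV ν ≤ normSqV ω) :
    IsCritical ν := by
  intro A hA
  have hmin : IsLocalMin (fun t => normSqV (flow A ν t)) 0 :=
    Filter.Eventually.of_forall fun t => by
      simp only [flow_zero]
      exact h _ (flow_mem_slOrbit hA ν t)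
  have := hmin.hasDerivAt_eq_zero (hasDerivAt_normSqV_flow A ν)
  linarith

lemma continuous_normSqV : Continuous (normSqV : Vn n → ℝ) := by
  unfold normSqV
  refine continuous_finsetSum _ fun i _ => continuous_finsetSum _ fun j _ =>
    continuous_finsetSum _ fun k _ => Complex.continuous_normSq.comp (by fun_prop)

lemma norm_sq_le_normSqV (μ : Vn n) : ‖μ‖ ≤ Real.sqrt (normSqV μ) := by
  have h0 := Real.sqrt_nonneg (normSqV μ)
  refine (pi_norm_le_iff_of_nonneg h0).mpr fun i => (pi_norm_le_iff_of_nonneg h0).mpr fun j =>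
    (pi_norm_le_iff_of_nonneg h0).mpr fun k => ?_
  refine Real.le_sqrt_of_sq_le ?_
  rw [← Complex.normSq_eq_norm_sq]
  exact normSq_le_normSqV μ i j k

lemma tendsto_normSqV : Filter.Tendsto (normSqV : Vn n → ℝ) (Filter.cocompact _) Filter.atTop := by
  refine Filter.tendsto_atTop_mono (f := fun μ : Vn n => ‖μ‖ ^ 2) (fun μ => ?_)
    ((Filter.tendsto_pow_atTop two_ne_zero).comp (tendsto_norm_cocompact_atTop (E := Vn n)))
  have := norm_sq_le_normSqV μ
  calc ‖μ‖ ^ 2 ≤ Real.sqrt (normSqV μ) ^ 2 := by gcongr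
    _ = _ := Real.sq_sqrt (normSqV_nonneg μ)

lemma exists_isCritical (μ : Vn n) : ∃ ν ∈ closure (slOrbit μ), IsCritical ν := by
  obtain ⟨ν, hν, hmin⟩ := continuous_normSqV.continuousOn.exists_isMinOn'
    (isClosed_closure (s := slOrbit μ)) (subset_closure (mem_slOrbit_self μ))
    (Filter.Eventually.filter_mono inf_le_left
      (tendsto_normSqV.eventually_ge_atTop (normSqV μ)))
  exact ⟨ν, hν, isCritical_of_forall_le fun ω hω =>
    hmin (closure_slOrbit_subset hν (subset_closure hω))⟩

/-! ### Derivations of Jordan algebras -/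

lemma L_add (μ : Vn n) (x y : Fin n → ℂ) : L μ (x + y) = L μ x + L μ y := by
  refine Matrix.ext_of_mulVec_single fun i => ?_
  simp only [add_mulVec, L_mulVec, mul_add_left]

lemma L_smul (μ : Vn n) (c : ℂ) (x : Fin n → ℂ) : L μ (c • x) = c • L μ x := by
  refine Matrix.ext_of_mulVec_single fun i => ?_
  simp only [smul_mulVec, L_mulVec, mul_smul_left]

lemma L_sub (μ : Vn n) (x y : Fin n → ℂ) : L μ (x - y) = L μ x - L μ y := by
  refine Matrix.ext_of_mulVec_single fun i => ?_
  simp only [sub_mulVec, L_mulVec, mul_sub_left]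

lemma ext_mulVec {A B : Matrix (Fin n) (Fin n) ℂ} (h : ∀ x, A *ᵥ x = B *ᵥ x) : A = B :=
  Matrix.ext_of_mulVec_single fun _ => h _

lemma IsSymm.mul_comm {μ : Vn n} (h : IsSymm μ) (x y : Fin n → ℂ) : mul μ x y = mul μ y x := by
  ext k
  simp only [mul]
  rw [Finset.sum_comm]
  refine Finset.sum_congr rfl fun i _ => Finset.sum_congr rfl fun j _ => ?_
  rw [h]
  ring

/-- the commutator `[L_a, L_b]` of left multiplications -/
def comm (μ : Vn n) (a b : Fin n → ℂ) : Matrix (Fin n) (Fin n) ℂ :=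
  L μ a * L μ b - L μ b * L μ a

lemma comm_mulVec (μ : Vn n) (a b x : Fin n → ℂ) :
    comm μ a b *ᵥ x = mul μ a (mul μ b x) - mul μ b (mul μ a x) := by
  simp only [comm, sub_mulVec, ← mulVec_mulVec, L_mulVec]

lemma IsJordan.isDeriv_comm {μ : Vn n} (hJ : IsJordan μ) (a b : Fin n → ℂ) :
    IsDeriv μ (comm μ a b) := by
  intro x y
  have hc := hJ.1.mul_comm
  have h1 := hJ.2 x y b a
  have h2 := hJ.2 x y a b
  simp only [comm_mulVec, assoc, mul_sub_left, mul_sub_right] at *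
  simp only [hc (mul μ x y), hc (mul μ a x), hc (mul μ b x),
    hc (mul μ _ (mul μ _ _)), hc y a, hc y b, hc b a] at *
  rw [hc x (mul μ b (mul μ a y)), hc x (mul μ a (mul μ b y)), hc y (mul μ b (mul μ a x)),
    hc y (mul μ a (mul μ b x))] at *
  have e1 := congrArg (mul μ · x) (hc (mul μ b y) a)
  have e2 := congrArg (mul μ · x) (hc (mul μ a y) b)
  linear_combination h1 - h2 + e1 - e2

lemma IsDeriv.mul_L_sub {μ : Vn n} {D : Matrix (Fin n) (Fin n) ℂ} (hD : IsDeriv μ D)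
    (x : Fin n → ℂ) : D * L μ x - L μ x * D = L μ (D *ᵥ x) := by
  refine ext_mulVec fun y => ?_
  simp only [sub_mulVec, ← mulVec_mulVec, L_mulVec, hD x y]
  abel

lemma trace_L_deriv {μ : Vn n} {D : Matrix (Fin n) (Fin n) ℂ} (hD : IsDeriv μ D)
    (x : Fin n → ℂ) : (L μ (D *ᵥ x)).trace = 0 := by
  rw [← hD.mul_L_sub, trace_sub, trace_mul_comm, sub_self]

lemma traceForm_add_left (μ : Vn n) (x y z : Fin n → ℂ) :
    traceForm μ (x + y) z = traceForm μ x z + traceForm μ y z := by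
  simp only [traceForm, mul_add_left, L_add, trace_add]

lemma traceForm_smul_left (μ : Vn n) (c : ℂ) (x z : Fin n → ℂ) :
    traceForm μ (c • x) z = c * traceForm μ x z := by
  simp only [traceForm, mul_smul_left, L_smul, trace_smul, smul_eq_mul]

lemma traceForm_comm {μ : Vn n} (h : IsSymm μ) (x y : Fin n → ℂ) :
    traceForm μ x y = traceForm μ y x := by
  simp only [traceForm, h.mul_comm x y]

lemma traceForm_deriv {μ : Vn n} {D : Matrix (Fin n) (Fin n) ℂ} (hD : IsDeriv μ D)
    (x y : Fin n → ℂ) : traceForm μ (D *ᵥ x) y = -traceForm μ x (D *ᵥ y) := by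
  have h := trace_L_deriv hD (mul μ x y)
  rw [hD x y, L_add, trace_add] at h
  exact eq_neg_of_add_eq_zero_left h

lemma IsJordan.traceForm_assoc {μ : Vn n} (hJ : IsJordan μ) (x y z : Fin n → ℂ) :
    traceForm μ (mul μ x y) z = traceForm μ x (mul μ y z) := by
  have h := trace_L_deriv (hJ.isDeriv_comm z x) y
  rw [comm_mulVec, L_sub, trace_sub, sub_eq_zero, hJ.1.mul_comm z (mul μ x y),
    hJ.1.mul_comm z y] at h
  exact h

/-- the Lie algebra of derivations of `μ` -/
def derSub (μ : Vn n) : Submodule ℂ (Matrix (Fin n) (Fin n) ℂ) where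
  carrier := {D | IsDeriv μ D}
  add_mem' {D E} hD hE x y := by
    simp only [add_mulVec, hD x y, hE x y, mul_add_left, mul_add_right]
    abel
  zero_mem' x y := by
    simp only [zero_mulVec, mul_zero_left]
    simp [← mulB_apply]
  smul_mem' c D hD x y := by
    simp only [smul_mulVec, hD x y, mul_smul_left, mul_smul_right, smul_add]

lemma mem_derSub {μ : Vn n} {D : Matrix (Fin n) (Fin n) ℂ} : D ∈ derSub μ ↔ IsDeriv μ D := Iff.rfl

lemma commutator_mem_derSub {μ : Vn n} {D E : Matrix (Fin n) (Fin n) ℂ} (hD : D ∈ derSub μ)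
    (hE : E ∈ derSub μ) : D * E - E * D ∈ derSub μ := by
  rw [mem_derSub, ← glAct_eq_zero_iff, glAct_mul_sub, glAct_eq_zero_iff.mpr hD,
    glAct_eq_zero_iff.mpr hE]
  simp [glAct_eq_tri, tri_zero]

/-- the adjoint action of a derivation on the Lie algebra of derivations -/
def adDer (μ : Vn n) : derSub μ →ₗ[ℂ] derSub μ →ₗ[ℂ] derSub μ :=
  LinearMap.mk₂ ℂ (fun D E => ⟨D.1 * E.1 - E.1 * D.1, commutator_mem_derSub D.2 E.2⟩)
    (fun D D' E => Subtype.ext (by simp [add_mul, mul_add]; abel))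
    (fun c D E => Subtype.ext (by simp [smul_sub]))
    (fun D E E' => Subtype.ext (by simp [add_mul, mul_add]; abel))
    (fun c D E => Subtype.ext (by simp [smul_sub]))

lemma coe_adDer (μ : Vn n) (D E : derSub μ) :
    (adDer μ D E : Matrix (Fin n) (Fin n) ℂ) = D.1 * E.1 - E.1 * D.1 := rfl

/-- the linear map `c ↦ [L_a, L_c]` -/
def commMap {μ : Vn n} (hJ : IsJordan μ) (a : Fin n → ℂ) : (Fin n → ℂ) →ₗ[ℂ] derSub μ where
  toFun c := ⟨comm μ a c, hJ.isDeriv_comm a c⟩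
  map_add' c c' := Subtype.ext (by simp [comm, L_add, add_mul, mul_add]; abel)
  map_smul' k c := Subtype.ext (by simp [comm, L_smul, smul_sub])

/-- the linear map `E ↦ -E b` -/
def negEval (μ : Vn n) (b : Fin n → ℂ) : derSub μ →ₗ[ℂ] (Fin n → ℂ) where
  toFun E := -(E.1 *ᵥ b)
  map_add' E E' := by simp [add_mulVec, add_comm]
  map_smul' k E := by simp [smul_mulVec]

lemma adDer_comm {μ : Vn n} (hJ : IsJordan μ) (a b : Fin n → ℂ) :
    adDer μ ⟨comm μ a b, hJ.isDeriv_comm a b⟩ =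
      commMap hJ a ∘ₗ negEval μ b - commMap hJ b ∘ₗ negEval μ a := by
  refine LinearMap.ext fun E => Subtype.ext ?_
  have ha := E.2.mul_L_sub a
  have hb := E.2.mul_L_sub b
  simp only [coe_adDer, commMap, negEval, comm, LinearMap.sub_apply, LinearMap.comp_apply,
    LinearMap.coe_mk, AddHom.coe_mk, Submodule.coe_sub]
  have hneg : ∀ x : Fin n → ℂ, L μ (-x) = -L μ x := fun x => by
    rw [← neg_one_smul ℂ x, L_smul, neg_one_smul]
  rw [hneg, hneg, ← ha, ← hb]
  noncomm_ring

lemma trace_mulVecLin (A : Matrix (Fin n) (Fin n) ℂ) :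
    LinearMap.trace ℂ _ (Matrix.mulVecLin A) = A.trace := by
  rw [← Matrix.toLin'_apply', Matrix.trace_toLin'_eq]

lemma trace_adDer_commMap {μ : Vn n} (hJ : IsJordan μ) (D : derSub μ) (a b : Fin n → ℂ) :
    LinearMap.trace ℂ _ (adDer μ D ∘ₗ commMap hJ a ∘ₗ negEval μ b) =
      -(D.1 * L μ a * L μ b).trace + (D.1 * L μ (mul μ a b)).trace
        + (L μ a * L μ (D.1 *ᵥ b)).trace - traceForm μ a (D.1 *ᵥ b) := by
  have e : negEval μ b ∘ₗ adDer μ D ∘ₗ commMap hJ a = Matrix.mulVecLin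
      (-(D.1 * L μ a * L μ b) + D.1 * L μ (mul μ a b)
        + L μ a * L μ (D.1 *ᵥ b) - L μ (mul μ a (D.1 *ᵥ b))) := by
    refine LinearMap.ext fun c => ?_
    have hc := hJ.1.mul_comm
    simp only [LinearMap.comp_apply, negEval, commMap, LinearMap.coe_mk, AddHom.coe_mk, coe_adDer,
      Matrix.mulVecLin_apply, sub_mulVec, add_mulVec, neg_mulVec, ← mulVec_mulVec, L_mulVec,
      comm_mulVec, mulVec_sub]
    rw [hc b c, hc c (mul μ a b), hc c (D.1 *ᵥ b), hc c (mul μ a (D.1 *ᵥ b))]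
    abel
  rw [← LinearMap.comp_assoc, ← LinearMap.trace_comp_comm', e, trace_mulVecLin]
  simp only [trace_add, trace_sub, trace_neg, traceForm]

lemma three_trace_add_trace_adDer {μ : Vn n} (hJ : IsJordan μ) (D : derSub μ) (a b : Fin n → ℂ) :
    3 * (D.1 * comm μ a b).trace +
      LinearMap.trace ℂ _ (adDer μ D ∘ₗ adDer μ ⟨comm μ a b, hJ.isDeriv_comm a b⟩) =
      2 * traceForm μ (D.1 *ᵥ a) b := by
  have hD : IsDeriv μ D.1 := D.2
  have h1 := trace_adDer_commMap hJ D a b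
  have h2 := trace_adDer_commMap hJ D b a
  have h3 : LinearMap.trace ℂ _ (adDer μ D ∘ₗ adDer μ ⟨comm μ a b, hJ.isDeriv_comm a b⟩) =
      LinearMap.trace ℂ _ (adDer μ D ∘ₗ commMap hJ a ∘ₗ negEval μ b) -
        LinearMap.trace ℂ _ (adDer μ D ∘ₗ commMap hJ b ∘ₗ negEval μ a) := by
    rw [adDer_comm hJ, LinearMap.comp_sub]
    exact map_sub (LinearMap.trace ℂ (derSub μ)) _ _
  rw [h3, h1, h2, hJ.1.mul_comm b a,
    traceForm_comm hJ.1 b, ← neg_eq_iff_eq_neg.mpr (traceForm_deriv hD a b)]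
  have hβ : ∀ x y, (L μ x * L μ (D.1 *ᵥ y)).trace =
      (D.1 * L μ y * L μ x).trace - (D.1 * L μ x * L μ y).trace := fun x y => by
    rw [← hD.mul_L_sub, mul_sub, trace_sub, trace_mul_comm, ← mul_assoc (L μ x),
      trace_mul_comm (L μ x * L μ y), mul_assoc D.1 (L μ x)]
  simp only [hβ, comm, mul_sub, trace_sub, ← mul_assoc]
  ring

/-- the span of the derivations `[L_a, L_b]` -/
def innSub (μ : Vn n) : Submodule ℂ (Matrix (Fin n) (Fin n) ℂ) :=
  Submodule.span ℂ (Set.range fun p : (Fin n → ℂ) × (Fin n → ℂ) => comm μ p.1 p.2)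

lemma IsJordan.innSub_le {μ : Vn n} (hJ : IsJordan μ) : innSub μ ≤ derSub μ := by
  refine Submodule.span_le.mpr ?_
  rintro _ ⟨p, rfl⟩
  exact hJ.isDeriv_comm p.1 p.2

/-- the bilinear form `3 Tr(DE) + Tr(ad D ad E)` on derivations -/
def derForm (μ : Vn n) : derSub μ →ₗ[ℂ] derSub μ →ₗ[ℂ] ℂ :=
  LinearMap.mk₂ ℂ
    (fun D E => 3 * (D.1 * E.1).trace + LinearMap.trace ℂ _ (adDer μ D ∘ₗ adDer μ E))
    (fun D D' E => by simp [add_mul, LinearMap.add_comp]; ring)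
    (fun c D E => by simp [LinearMap.smul_comp]; ring)
    (fun D E E' => by simp [mul_add, LinearMap.comp_add]; ring)
    (fun c D E => by simp [LinearMap.comp_smul]; ring)

lemma derForm_comm {μ : Vn n} (hJ : IsJordan μ) (D : derSub μ) (a b : Fin n → ℂ) :
    derForm μ D ⟨comm μ a b, hJ.isDeriv_comm a b⟩ = 2 * traceForm μ (D.1 *ᵥ a) b :=
  three_trace_add_trace_adDer hJ D a b

lemma IsJordan.derSub_eq_innSub {μ : Vn n} (hJ : IsJordan μ) (hτ : TraceFormNondeg μ) :
    innSub μ = derSub μ := by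
  refine Submodule.eq_of_le_of_finrank_le hJ.innSub_le ?_
  rw [← Subspace.dual_finrank_eq (K := ℂ) (V := innSub μ)]
  refine LinearMap.finrank_le_finrank_of_injective
    (f := (derForm μ).compl₂ (Submodule.inclusion hJ.innSub_le)) ?_
  refine (injective_iff_map_eq_zero _).mpr fun D hD => Subtype.ext (ext_mulVec fun a => ?_)
  rw [Submodule.coe_zero, zero_mulVec]
  refine hτ _ fun b => ?_
  have h := LinearMap.congr_fun hD ⟨comm μ a b, Submodule.subset_span ⟨(a, b), rfl⟩⟩
  rw [LinearMap.compl₂_apply] at h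
  have h' := (derForm_comm hJ D a b).symm.trans h
  simpa using h'

/-! ### Closures of orbits of Jordan algebras -/

lemma mul_slAct (g : Matrix.SpecialLinearGroup (Fin n) ℂ) (μ : Vn n) (x y : Fin n → ℂ) :
    mul (slAct g μ) x y = (g : Matrix (Fin n) (Fin n) ℂ) *ᵥ
      mul μ ((↑g⁻¹ : Matrix (Fin n) (Fin n) ℂ) *ᵥ x)
        ((↑g⁻¹ : Matrix (Fin n) (Fin n) ℂ) *ᵥ y) := by
  rw [slAct_eq_tri, mul_tri]

lemma isSymm_of_mul_comm {μ : Vn n} (h : ∀ x y, mul μ x y = mul μ y x) : IsSymm μ := fun i j k => by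
  rw [← mul_single_single μ i j, h, mul_single_single]

lemma IsJordan.slAct {μ : Vn n} (hJ : IsJordan μ) (g : Matrix.SpecialLinearGroup (Fin n) ℂ) :
    IsJordan (slAct g μ) := by
  refine ⟨isSymm_of_mul_comm fun x y => ?_, fun a b c d => ?_⟩
  · rw [mul_slAct, mul_slAct, hJ.1.mul_comm]
  · have h := congrArg ((g : Matrix (Fin n) (Fin n) ℂ) *ᵥ ·)
      (hJ.2 ((↑g⁻¹ : Matrix (Fin n) (Fin n) ℂ) *ᵥ a) ((↑g⁻¹ : Matrix (Fin n) (Fin n) ℂ) *ᵥ b)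
        ((↑g⁻¹ : Matrix (Fin n) (Fin n) ℂ) *ᵥ c) ((↑g⁻¹ : Matrix (Fin n) (Fin n) ℂ) *ᵥ d))
    simp only [assoc, mulVec_add, mulVec_sub, mulVec_zero] at h
    simp only [assoc, mul_slAct, mulVec_mulVec, sl_inv_mul, one_mulVec]
    simpa only [mulVec_mulVec, sl_inv_mul, one_mulVec] using h

lemma _root_.Continuous.vnMul {X : Type*} [TopologicalSpace X] {f : X → Vn n}
    {g h : X → Fin n → ℂ} (hf : Continuous f) (hg : Continuous g) (hh : Continuous h) :
    Continuous fun t => mul (f t) (g t) (h t) := by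
  have h := (continuous_mul (n := n)).comp (hf.prodMk (hg.prodMk hh))
  exact h

lemma continuous_assoc {X : Type*} [TopologicalSpace X] {f : X → Vn n}
    {a b c : X → Fin n → ℂ} (hf : Continuous f) (ha : Continuous a) (hb : Continuous b)
    (hc : Continuous c) : Continuous fun t => assoc (f t) (a t) (b t) (c t) :=
  (hf.vnMul (hf.vnMul ha hb) hc).sub (hf.vnMul ha (hf.vnMul hb hc))

lemma isClosed_isJordan : IsClosed {μ : Vn n | IsJordan μ} := by
  simp only [IsJordan, IsSymm, Set.ofPred_and, Set.ofPred_forall]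
  refine IsClosed.inter ?_ ?_
  · refine isClosed_iInter fun i => isClosed_iInter fun j => isClosed_iInter fun k =>
      isClosed_eq (by fun_prop) (by fun_prop)
  · refine isClosed_iInter fun a => isClosed_iInter fun b => isClosed_iInter fun c =>
      isClosed_iInter fun d => isClosed_eq ?_ continuous_const
    have hm : ∀ x y : Fin n → ℂ, Continuous fun μ : Vn n => mul μ x y := fun x y =>
      continuous_id.vnMul continuous_const continuous_const
    exact ((continuous_assoc continuous_id (hm a b) continuous_const continuous_const).add
      (continuous_assoc continuous_id (hm b d) continuous_const continuous_const)).add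
      (continuous_assoc continuous_id (hm d a) continuous_const continuous_const)

lemma IsJordan.of_mem_closure {μ ν : Vn n} (hJ : IsJordan μ) (h : ν ∈ closure (slOrbit μ)) :
    IsJordan ν := by
  refine closure_minimal ?_ isClosed_isJordan h
  rintro _ ⟨g, rfl⟩
  exact hJ.slAct g

lemma traceForm_add_right (μ : Vn n) (x y z : Fin n → ℂ) :
    traceForm μ x (y + z) = traceForm μ x y + traceForm μ x z := by
  simp only [traceForm, mul_add_right, L_add, trace_add]

lemma traceForm_smul_right (μ : Vn n) (c : ℂ) (x z : Fin n → ℂ) :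
    traceForm μ x (c • z) = c * traceForm μ x z := by
  simp only [traceForm, mul_smul_right, L_smul, trace_smul, smul_eq_mul]

/-- the trace form as a bilinear map -/
def traceB (μ : Vn n) : (Fin n → ℂ) →ₗ[ℂ] (Fin n → ℂ) →ₗ[ℂ] ℂ :=
  LinearMap.mk₂ ℂ (traceForm μ) (traceForm_add_left μ) (traceForm_smul_left μ)
    (traceForm_add_right μ) (traceForm_smul_right μ)

/-- the Gram matrix of the trace form -/
def gram (μ : Vn n) : Matrix (Fin n) (Fin n) ℂ :=
  of fun i j => traceForm μ (Pi.single i 1) (Pi.single j 1)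

lemma traceForm_eq_dotProduct (μ : Vn n) (x y : Fin n → ℂ) :
    traceForm μ x y = x ⬝ᵥ gram μ *ᵥ y := by
  have h : traceB μ = Matrix.toLinearMap₂' ℂ (gram μ) := by
    refine (Pi.basisFun ℂ (Fin n)).ext fun i => (Pi.basisFun ℂ (Fin n)).ext fun j => ?_
    simp [Matrix.toLinearMap₂'_apply', traceB, gram]
  have := LinearMap.congr_fun₂ h x y
  rwa [Matrix.toLinearMap₂'_apply'] at this

lemma traceFormNondeg_iff {μ : Vn n} : TraceFormNondeg μ ↔ (gram μ).det ≠ 0 := by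
  rw [ne_eq, ← Matrix.exists_vecMul_eq_zero_iff]
  push Not
  refine forall_congr' fun x => ?_
  rw [← not_imp_not, not_imp_not]
  have : (∀ y, traceForm μ x y = 0) ↔ x ᵥ* gram μ = 0 := by
    simp only [traceForm_eq_dotProduct, dotProduct_mulVec]
    exact dotProduct_eq_zero_iff
  rw [this]
  tauto

lemma traceForm_slAct (g : Matrix.SpecialLinearGroup (Fin n) ℂ) (μ : Vn n) (x y : Fin n → ℂ) :
    traceForm (slAct g μ) x y = traceForm μ ((↑g⁻¹ : Matrix (Fin n) (Fin n) ℂ) *ᵥ x)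
      ((↑g⁻¹ : Matrix (Fin n) (Fin n) ℂ) *ᵥ y) := by
  have hL : ∀ z, L (slAct g μ) z = (g : Matrix (Fin n) (Fin n) ℂ) *
      L μ ((↑g⁻¹ : Matrix (Fin n) (Fin n) ℂ) *ᵥ z) * (↑g⁻¹ : Matrix (Fin n) (Fin n) ℂ) :=
    fun z => ext_mulVec fun y => by
      simp only [L_mulVec, mul_slAct, ← mulVec_mulVec]
  rw [traceForm, hL, trace_mul_comm, ← mul_assoc, sl_inv_mul, one_mul, mul_slAct, mulVec_mulVec,
    sl_inv_mul, one_mulVec, traceForm]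

lemma det_gram_slAct (g : Matrix.SpecialLinearGroup (Fin n) ℂ) (μ : Vn n) :
    (gram (slAct g μ)).det = (gram μ).det := by
  have h : gram (slAct g μ) = (↑g⁻¹ : Matrix (Fin n) (Fin n) ℂ)ᵀ * gram μ *
      (↑g⁻¹ : Matrix (Fin n) (Fin n) ℂ) := by
    ext i j
    rw [gram, of_apply, traceForm_slAct, traceForm_eq_dotProduct, mulVec_mulVec,
      dotProduct_mulVec, ← vecMul_transpose, vecMul_vecMul, ← mul_assoc]
    simp
  rw [h, det_mul, det_mul, det_transpose, Matrix.SpecialLinearGroup.det_coe, one_mul, mul_one]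

lemma continuous_det_gram : Continuous fun μ : Vn n => (gram μ).det := by
  refine Continuous.matrix_det (continuous_pi fun i => continuous_pi fun j => ?_)
  simp only [gram, of_apply, traceForm]
  exact Continuous.matrix_trace (continuous_L.comp (continuous_id.prodMk
    (continuous_id.vnMul continuous_const continuous_const)))

lemma traceFormNondeg_iff_of_mem_closure {μ ν : Vn n} (hν : ν ∈ closure (slOrbit μ)) :
    TraceFormNondeg ν ↔ TraceFormNondeg μ := by
  have : ν ∈ {ν : Vn n | (gram ν).det = (gram μ).det} := by
    refine closure_minimal ?_ (isClosed_eq continuous_det_gram continuous_const) hν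
    rintro _ ⟨g, rfl⟩
    exact det_gram_slAct g μ
  rw [traceFormNondeg_iff, traceFormNondeg_iff, this]

/-! ### Critical points with degenerate trace form -/

lemma re_trace_conjTranspose_mul_self (A : Matrix (Fin n) (Fin n) ℂ) :
    (Aᴴ * A).trace.re = ∑ i, ∑ j, Complex.normSq (A j i) := by
  simp only [trace, diag_apply, mul_apply, conjTranspose_apply, Complex.re_sum]
  refine Finset.sum_congr rfl fun i _ => Finset.sum_congr rfl fun j _ => ?_
  simp [Complex.normSq_apply]

lemma re_trace_conjTranspose_mul_self_nonneg (A : Matrix (Fin n) (Fin n) ℂ) :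
    0 ≤ (Aᴴ * A).trace.re := by
  rw [re_trace_conjTranspose_mul_self]
  exact Finset.sum_nonneg fun _ _ => Finset.sum_nonneg fun _ _ => Complex.normSq_nonneg _

lemma eq_zero_of_re_trace_conjTranspose_mul_self {A : Matrix (Fin n) (Fin n) ℂ}
    (h : (Aᴴ * A).trace.re = 0) : A = 0 := by
  rw [re_trace_conjTranspose_mul_self,
    Finset.sum_eq_zero_iff_of_nonneg
      (fun _ _ => Finset.sum_nonneg fun _ _ => Complex.normSq_nonneg _)] at h
  ext i j
  have := (Finset.sum_eq_zero_iff_of_nonneg (fun _ _ => Complex.normSq_nonneg _)).mp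
    (h j (Finset.mem_univ j)) i (Finset.mem_univ i)
  exact Complex.normSq_eq_zero.mp this

lemma trace_comp_nonneg_of_core {V : Type*} [AddCommGroup V] [Module ℂ V] [FiniteDimensional ℂ V]
    (c : InnerProductSpace.Core ℂ V) (f g : V →ₗ[ℂ] V)
    (h : ∀ x y, c.inner (f x) y = c.inner x (g y)) : 0 ≤ (LinearMap.trace ℂ V (g ∘ₗ f)).re := by
  let : NormedAddCommGroup V := c.toNormedAddCommGroup
  let : InnerProductSpace ℂ V := InnerProductSpace.ofCore c.toCore
  rw [LinearMap.trace_eq_sum_inner (g ∘ₗ f) (stdOrthonormalBasis ℂ V), Complex.re_sum]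
  refine Finset.sum_nonneg fun i _ => ?_
  have := h (stdOrthonormalBasis ℂ V i) (f (stdOrthonormalBasis ℂ V i))
  refine le_of_le_of_eq (c.re_inner_nonneg (f (stdOrthonormalBasis ℂ V i))) ?_
  exact congrArg Complex.re this

/-- the Frobenius inner product on a space of matrices -/
abbrev frobCore (W : Submodule ℂ (Matrix (Fin n) (Fin n) ℂ)) : InnerProductSpace.Core ℂ W where
  inner X Y := (X.1ᴴ * Y.1).trace
  conj_inner_symm X Y := by
    rw [starRingEnd_apply, ← trace_conjTranspose, conjTranspose_mul, conjTranspose_conjTranspose]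
  re_inner_nonneg X := re_trace_conjTranspose_mul_self_nonneg X.1
  add_left X Y Z := by simp [add_mul]
  smul_left X Y r := by simp
  definite X hX := Subtype.ext <| eq_zero_of_re_trace_conjTranspose_mul_self <| by
    rw [hX, Complex.zero_re]

lemma innerV_smul_left (c : ℂ) (μ ν : Vn n) : innerV (c • μ) ν = c * innerV μ ν := by
  simp [innerV, Finset.mul_sum, mul_assoc]

lemma innerV_neg_left (μ ν : Vn n) : innerV (-μ) ν = -innerV μ ν := by
  simp [innerV, Finset.sum_neg_distrib]

lemma glAct_smul_left (c : ℂ) (A : Matrix (Fin n) (Fin n) ℂ) (μ : Vn n) :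
    glAct (c • A) μ = c • glAct A μ := by
  ext i j k
  simp only [glAct, smul_mulVec, mul_smul_left, mul_smul_right, Pi.smul_apply, Pi.sub_apply,
    smul_sub]

lemma glAct_zero (A : Matrix (Fin n) (Fin n) ℂ) : glAct A (0 : Vn n) = 0 := by
  simp [glAct_eq_tri, tri_zero]

lemma IsCritical.inner_glAct {ν : Vn n} (h : IsCritical ν) (P : Matrix (Fin n) (Fin n) ℂ) :
    n * (innerV (glAct P ν) ν).re = -(P.trace.re * normSqV ν) := by
  have := h ((n : ℂ) • P - P.trace • (1 : Matrix (Fin n) (Fin n) ℂ)) (by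
    simp [mul_comm])
  rw [glAct_sub_left, glAct_smul_left, glAct_smul_one, innerV_sub_left, innerV_smul_left,
    innerV_neg_left, innerV_smul_left, innerV_self] at this
  simp at this
  linarith

lemma IsCritical.isDeriv_conjTranspose {ν : Vn n} (h : IsCritical ν)
    {A : Matrix (Fin n) (Fin n) ℂ} (hA : IsDeriv ν A) : IsDeriv ν Aᴴ := by
  have h1 := h (A * Aᴴ - Aᴴ * A) (by rw [trace_sub, trace_mul_comm, sub_self])
  rw [glAct_mul_sub, glAct_eq_zero_iff.mpr hA, glAct_zero, sub_zero, innerV_glAct, innerV_self,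
    Complex.ofReal_re] at h1
  exact glAct_eq_zero_iff.mp (eq_zero_of_normSqV h1)

/-- in a critical Jordan algebra, the radical of the trace form consists of elements whose
multiplication operators commute with all multiplication operators -/
lemma IsCritical.comm_eq_zero {ν : Vn n} (h : IsCritical ν) (hJ : IsJordan ν) {x : Fin n → ℂ}
    (hx : ∀ y, traceForm ν x y = 0) (a : Fin n → ℂ) : comm ν x a = 0 := by
  have hD := hJ.isDeriv_comm x a
  have hE := h.isDeriv_conjTranspose hD
  have h1 : 3 * ((comm ν x a)ᴴ * comm ν x a).trace +
      LinearMap.trace ℂ _ (adDer ν ⟨_, hE⟩ ∘ₗ adDer ν ⟨_, hD⟩) = 0 := by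
    rw [three_trace_add_trace_adDer hJ ⟨_, hE⟩ x a, traceForm_deriv hE, hx]
    simp
  have h2 := trace_comp_nonneg_of_core (frobCore (derSub ν)) (adDer ν ⟨_, hD⟩)
    (adDer ν ⟨_, hE⟩) fun X Y => by
      change ((comm ν x a * X.1 - X.1 * comm ν x a)ᴴ * Y.1).trace =
        (X.1ᴴ * ((comm ν x a)ᴴ * Y.1 - Y.1 * (comm ν x a)ᴴ)).trace
      rw [conjTranspose_sub, conjTranspose_mul, conjTranspose_mul, sub_mul, mul_sub, trace_sub,
        trace_sub, mul_assoc, trace_mul_comm ((comm ν x a)ᴴ * X.1ᴴ), ← mul_assoc, ← mul_assoc,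
        trace_mul_comm X.1ᴴ (Y.1 * (comm ν x a)ᴴ)]
  have h3 := re_trace_conjTranspose_mul_self_nonneg (comm ν x a)
  have h4 := congrArg Complex.re h1
  simp at h4
  exact eq_zero_of_re_trace_conjTranspose_mul_self (by linarith)

open Polynomial in
/-- a matrix `T` with `Tr (q(T) T²) = 0` for all polynomials `q` is nilpotent -/
lemma isNilpotent_of_trace_aeval {T : Matrix (Fin n) (Fin n) ℂ}
    (h : ∀ q : ℂ[X], (aeval T q * T ^ 2).trace = 0) : IsNilpotent T := by
  obtain ⟨q, hq, hdvd⟩ := exists_eq_pow_rootMultiplicity_mul_and_not_dvd T.charpoly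
    T.charpoly_monic.ne_zero 0
  rw [C_0, sub_zero] at hq hdvd
  set m := rootMultiplicity 0 T.charpoly
  have hcop : IsCoprime (X ^ (m + 2)) q :=
    ((prime_X.irreducible.coprime_iff_not_dvd).mpr hdvd).pow_left
  obtain ⟨u, v, huv⟩ := hcop
  have hCH : aeval T (X ^ m * q) = 0 := by rw [← hq]; exact T.aeval_self_charpoly
  set E := aeval T (u * X ^ (m + 2)) with hE
  have hE1 : E + aeval T (v * q) = 1 := by
    rw [hE, ← map_add, huv, map_one]
  have hE2 : E * aeval T (v * q) = 0 := by
    rw [hE, ← map_mul, show u * X ^ (m + 2) * (v * q) = (u * X ^ 2 * v) * (X ^ m * q) by ring,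
      map_mul, hCH, mul_zero]
  have hid : IsIdempotentElem E := by
    have : E * (E + aeval T (v * q)) = E := by rw [hE1, mul_one]
    rwa [mul_add, hE2, add_zero] at this
  have htr : E.trace = 0 := by
    rw [hE, show u * X ^ (m + 2) = (u * X ^ m) * X ^ 2 by ring, map_mul, map_pow, aeval_X]
    exact h _
  have hE0 : E = 0 := by
    have hid' : IsIdempotentElem (Matrix.toLin' E) := by
      rw [IsIdempotentElem, Module.End.mul_eq_comp, ← Matrix.toLin'_mul, hid.eq]
    have := LinearMap.IsIdempotentElem.eq_zero_of_trace_eq_zero hid' (by rw [Matrix.trace_toLin'_eq, htr])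
    simpa using this
  refine ⟨m, ?_⟩
  rw [hE0, zero_add] at hE1
  calc T ^ m = T ^ m * aeval T (v * q) := by rw [hE1, mul_one]
    _ = aeval T v * aeval T (X ^ m * q) := by
      rw [← map_mul, show v * (X ^ m * q) = X ^ m * (v * q) by ring, map_mul (aeval T) (X ^ m),
        map_pow, aeval_X]
    _ = 0 := by rw [hCH, mul_zero]

/-- the matrix of the orthogonal projection onto a subspace of `ℂⁿ` -/
lemma exists_projection (I : Submodule ℂ (Fin n → ℂ)) : ∃ P : Matrix (Fin n) (Fin n) ℂ,
    Pᴴ = P ∧ (∀ v ∈ I, P *ᵥ v = v) ∧ ∀ v, P *ᵥ v ∈ I := by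
  let K : Submodule ℂ (EuclideanSpace ℂ (Fin n)) :=
    I.comap (WithLp.linearEquiv 2 ℂ (Fin n → ℂ)).toLinearMap
  let P : Matrix (Fin n) (Fin n) ℂ := Matrix.toEuclideanLin.symm K.starProjection.toLinearMap
  have hP : ∀ v, P *ᵥ v = WithLp.ofLp (K.starProjection (WithLp.toLp 2 v)) := fun v => by
    have : Matrix.toEuclideanLin P (WithLp.toLp 2 v) = K.starProjection (WithLp.toLp 2 v) := by
      simp only [P, LinearEquiv.apply_symm_apply]
      rfl
    rw [← this]
    rfl
  refine ⟨P, ?_, fun v hv => ?_, fun v => ?_⟩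
  · have := (Matrix.isSymmetric_toEuclideanLin_iff (A := P)).mp (by
      simp only [P, LinearEquiv.apply_symm_apply]
      exact K.starProjection_isSymmetric)
    exact this
  · rw [hP, K.starProjection_eq_self_iff.mpr hv]
  · rw [hP]
    exact K.starProjection_apply_mem (WithLp.toLp 2 v)

/-- a critical algebra has no nonzero ideal with vanishing square -/
lemma IsCritical.eq_bot_of_ideal {ν : Vn n} (h : IsCritical ν) (h0 : ν ≠ 0) (hs : IsSymm ν)
    (I : Submodule ℂ (Fin n → ℂ)) (hI : ∀ a, ∀ x ∈ I, mul ν a x ∈ I)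
    (hI2 : ∀ x ∈ I, ∀ y ∈ I, mul ν x y = 0) : I = ⊥ := by
  obtain ⟨P, hPh, hPI, hmem⟩ := exists_projection I
  set Q := 1 - P with hQ
  have hPP : P * P = P := ext_mulVec fun v => by
    rw [← mulVec_mulVec, hPI _ (hmem v)]
  have hQQ : Q * Q = Q := by
    rw [hQ, sub_mul, mul_sub, mul_sub, hPP]; simp
  have hQh : Qᴴ = Q := by rw [hQ, conjTranspose_sub, hPh, conjTranspose_one]
  have hact : glAct P ν = tri P Q Q ν := by
    refine ext_mul fun x y => ?_
    have e1 : P *ᵥ mul ν (P *ᵥ x) y = mul ν (P *ᵥ x) y :=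
      hPI _ (hs.mul_comm y _ ▸ hI y _ (hmem x))
    have e2 : P *ᵥ mul ν x (P *ᵥ y) = mul ν x (P *ᵥ y) := hPI _ (hI x _ (hmem y))
    have e3 := hI2 _ (hmem x) _ (hmem y)
    simp only [mul_glAct, mul_tri, hQ, sub_mulVec, one_mulVec, mul_sub_left, mul_sub_right,
      mulVec_sub, e1, e2, e3, mulVec_zero]
    abel
  have h1 := h.inner_glAct P
  have h2 : innerV (glAct P ν) ν = normSqV (tri P Q Q ν) := by
    rw [← innerV_self, innerV_tri, hPh, hQh, tri_tri, hPP, hQQ, hact, innerV_tri, hPh, hQh]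
  have h3 : P.trace.re = 0 := by
    have h4 := re_trace_conjTranspose_mul_self_nonneg P
    rw [hPh, hPP] at h4
    have h5 : 0 < normSqV ν := lt_of_le_of_ne (normSqV_nonneg ν)
      fun hz => h0 (eq_zero_of_normSqV hz.symm)
    have h6 := normSqV_nonneg (tri P Q Q ν)
    rw [h2, Complex.ofReal_re] at h1
    have h7 : (0 : ℝ) ≤ n * normSqV (tri P Q Q ν) := by positivity
    nlinarith
  have hP0 : P = 0 := eq_zero_of_re_trace_conjTranspose_mul_self (by rw [hPh, hPP, h3])
  refine (Submodule.eq_bot_iff I).mpr fun v hv => ?_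
  rw [← hPI v hv, hP0, zero_mulVec]

open Polynomial in
lemma IsCritical.traceFormNondeg {ν : Vn n} (h : IsCritical ν) (hJ : IsJordan ν) (h0 : ν ≠ 0) :
    TraceFormNondeg ν := by
  have hc := hJ.1.mul_comm
  have hcomm : ∀ y, (∀ z, traceForm ν y z = 0) → ∀ a, L ν y * L ν a = L ν a * L ν y :=
    fun y hy a => sub_eq_zero.mp (h.comm_eq_zero hJ hy a)
  have hmul : ∀ y, (∀ z, traceForm ν y z = 0) → ∀ a, L ν (mul ν y a) = L ν y * L ν a :=
    fun y hy a => ext_mulVec fun w => by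
      have := congrArg (· *ᵥ a) (hcomm y hy w)
      simp only [← mulVec_mulVec, L_mulVec] at this ⊢
      rw [hc a w, this, hc w]
  intro y hy
  by_contra hy0
  have hpoly : ∀ q : ℂ[X], L ν (aeval (L ν y) q *ᵥ y) = aeval (L ν y) q * L ν y := by
    intro q
    induction q using Polynomial.induction_on' with
    | add p q hp hq => rw [map_add, add_mulVec, L_add, hp, hq, add_mul]
    | monomial k c =>
      simp only [aeval_monomial, ← Algebra.smul_def, smul_mulVec, L_smul, smul_mul_assoc]
      congr 1
      induction k with
      | zero => simp
      | succ k ih => rw [pow_succ', ← mulVec_mulVec, L_mulVec, hmul y hy, ih, mul_assoc]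
  have hnil : IsNilpotent (L ν y) := by
    refine isNilpotent_of_trace_aeval fun q => ?_
    rw [pow_two, ← mul_assoc, ← hpoly, trace_mul_comm, ← hmul y hy]
    exact hy _
  obtain ⟨N, hN⟩ := hnil
  have hex : ∃ m, (L ν y) ^ m *ᵥ y = 0 := ⟨N, by rw [hN, zero_mulVec]⟩
  classical
  obtain ⟨m, hm⟩ : ∃ m, Nat.find hex = m + 1 := by
    refine Nat.exists_eq_succ_of_ne_zero fun hz => hy0 ?_
    have := Nat.find_spec hex
    rwa [hz, pow_zero, one_mulVec] at this
  set x := (L ν y) ^ m *ᵥ y with hx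
  have hx0 : x ≠ 0 := Nat.find_min hex (m := m) (by omega)
  have hLx : L ν x = (L ν y) ^ m * L ν y := by
    have := hpoly (X ^ m)
    simpa using this
  have hxrad : ∀ z, traceForm ν x z = 0 := by
    have : ∀ k z, traceForm ν ((L ν y) ^ k *ᵥ y) z = 0 := by
      intro k
      induction k with
      | zero => simpa using hy
      | succ k ih =>
        intro z
        rw [pow_succ', ← mulVec_mulVec, L_mulVec, hJ.traceForm_assoc]
        exact hy _
    exact this m
  have hxx : mul ν x x = 0 := by
    have h1 := Nat.find_spec hex
    rw [hm] at h1
    rw [← L_mulVec, hLx, ← pow_succ, hx, mulVec_mulVec, ← pow_add, add_comm, pow_add,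
      ← mulVec_mulVec, h1, mulVec_zero]
  have hLL : L ν x * L ν x = 0 := by
    rw [← hmul x hxrad, hxx, ← zero_smul ℂ (0 : Fin n → ℂ), L_smul, zero_smul]
  let I : Submodule ℂ (Fin n → ℂ) :=
    Submodule.span ℂ {x} ⊔ LinearMap.range (Matrix.mulVecLin (L ν x))
  have hI : ∀ v, v ∈ I ↔ ∃ (c : ℂ) (b : Fin n → ℂ), v = c • x + mul ν x b := by
    intro v
    simp only [I, Submodule.mem_sup, Submodule.mem_span_singleton, LinearMap.mem_range,
      Matrix.mulVecLin_apply, L_mulVec]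
    constructor
    · rintro ⟨_, ⟨c, rfl⟩, _, ⟨b, rfl⟩, rfl⟩
      exact ⟨c, b, rfl⟩
    · rintro ⟨c, b, rfl⟩
      exact ⟨_, ⟨c, rfl⟩, _, ⟨b, rfl⟩, rfl⟩
  have hperm : ∀ a b, mul ν a (mul ν x b) = mul ν x (mul ν a b) := fun a b => by
    have := congrArg (· *ᵥ b) (hcomm x hxrad a)
    simp only [← mulVec_mulVec, L_mulVec] at this
    exact this.symm
  have hsq : ∀ b, mul ν x (mul ν x b) = 0 := fun b => by
    have := congrArg (· *ᵥ b) hLL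
    simpa only [← mulVec_mulVec, L_mulVec, zero_mulVec] using this
  have hbot : I = ⊥ := by
    refine h.eq_bot_of_ideal h0 hJ.1 I (fun a v hv => ?_) fun v hv w hw => ?_
    · obtain ⟨c, b, rfl⟩ := (hI v).mp hv
      refine (hI _).mpr ⟨0, c • a + mul ν a b, ?_⟩
      rw [mul_add_right, mul_smul_right, hperm, hc a x, zero_smul, zero_add, mul_add_right,
        mul_smul_right]
    · obtain ⟨c, b, rfl⟩ := (hI v).mp hv
      obtain ⟨d, e, rfl⟩ := (hI w).mp hw
      simp only [mul_add_left, mul_add_right, mul_smul_left, mul_smul_right, hxx, hsq, hperm]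
      rw [hc (mul ν x b) x, hsq, hc (mul ν x b) e, hperm e b, hsq]
      simp
  have hxI : x ∈ I := (hI x).mpr ⟨1, 0, by
    rw [one_smul, ← L_mulVec, mulVec_zero, add_zero]⟩
  rw [hbot] at hxI
  exact hx0 ((Submodule.mem_bot ℂ).mp hxI)

/-! ### Degenerations to critical algebras -/

/-- the matrices of determinant one intertwining the products `w` and `μ` -/
def isoSet (w μ : Vn n) : Set (Matrix (Fin n) (Fin n) ℂ) :=
  {γ | γ.det = 1 ∧ ∀ x y, γ *ᵥ mul w x y = mul μ (γ *ᵥ x) (γ *ᵥ y)}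

lemma isoSet_nonempty {w μ : Vn n} (h : w ∈ slOrbit μ) : (isoSet w μ).Nonempty := by
  obtain ⟨g, hg⟩ := slOrbit_symm h
  refine ⟨g, g.det_coe, fun x y => ?_⟩
  rw [hg, mul_slAct, mulVec_mulVec, mulVec_mulVec, sl_inv_mul, one_mulVec, one_mulVec]

lemma isClosed_isoSet_prod (μ : Vn n) :
    IsClosed {p : Vn n × Matrix (Fin n) (Fin n) ℂ | p.2 ∈ isoSet p.1 μ} := by
  have h : ∀ x y, IsClosed {p : Vn n × Matrix (Fin n) (Fin n) ℂ |
      p.2 *ᵥ mul p.1 x y = mul μ (p.2 *ᵥ x) (p.2 *ᵥ y)} := fun x y =>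
    isClosed_eq (continuous_snd.matrix_mulVec
        (continuous_fst.vnMul continuous_const continuous_const))
      (continuous_const.vnMul (continuous_snd.matrix_mulVec continuous_const)
        (continuous_snd.matrix_mulVec continuous_const))
  have heq : {p : Vn n × Matrix (Fin n) (Fin n) ℂ | p.2 ∈ isoSet p.1 μ} =
      {p | p.2.det = 1} ∩ ⋂ x, ⋂ y, {p | p.2 *ᵥ mul p.1 x y = mul μ (p.2 *ᵥ x) (p.2 *ᵥ y)} := by
    ext p
    simp [isoSet]
  rw [heq]
  exact (isClosed_eq continuous_snd.matrix_det continuous_const).inter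
    (isClosed_iInter fun x => isClosed_iInter fun y => h x y)

lemma isCompact_re_trace_le (C : ℝ) :
    IsCompact {γ : Matrix (Fin n) (Fin n) ℂ | (γᴴ * γ).trace.re ≤ C} := by
  have hc : IsCompact (Set.pi Set.univ fun _ : Fin n => Set.pi Set.univ fun _ : Fin n =>
      Metric.closedBall (0 : ℂ) (Real.sqrt C)) :=
    isCompact_univ_pi fun _ => isCompact_univ_pi fun _ => isCompact_closedBall _ _
  refine IsCompact.of_isClosed_subset (X := Matrix (Fin n) (Fin n) ℂ) hc
    (isClosed_le (Complex.continuous_re.comp (Continuous.matrix_trace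
      (continuous_id.matrix_conjTranspose.matrix_mul continuous_id))) continuous_const) ?_
  intro γ hγ i _ j _
  rw [mem_closedBall_zero_iff]
  refine Real.le_sqrt_of_sq_le ?_
  rw [← Complex.normSq_eq_norm_sq]
  refine le_trans ?_ hγ
  rw [re_trace_conjTranspose_mul_self]
  refine le_trans (Finset.single_le_sum (f := fun i => Complex.normSq (γ i j))
    (fun _ _ => Complex.normSq_nonneg _) (Finset.mem_univ i)) ?_
  exact Finset.single_le_sum (f := fun j => ∑ i, Complex.normSq (γ i j))
    (fun _ _ => Finset.sum_nonneg fun _ _ => Complex.normSq_nonneg _) (Finset.mem_univ j)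

lemma exists_min_isoSet {w μ : Vn n} (h : w ∈ slOrbit μ) : ∃ γ ∈ isoSet w μ,
    ∀ γ' ∈ isoSet w μ, (γᴴ * γ).trace.re ≤ (γ'ᴴ * γ').trace.re := by
  obtain ⟨γ₀, hγ₀⟩ := isoSet_nonempty h
  have hcont : Continuous fun γ : Matrix (Fin n) (Fin n) ℂ => (γᴴ * γ).trace.re :=
    Complex.continuous_re.comp (Continuous.matrix_trace
      (continuous_id.matrix_conjTranspose.matrix_mul continuous_id))
  have hcl : IsClosed (isoSet w μ) :=
    (isClosed_isoSet_prod μ).preimage (Continuous.prodMk_right w)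
  obtain ⟨γ, hγ, hmin⟩ := ((isCompact_re_trace_le (γ₀ᴴ * γ₀).trace.re).inter_left hcl).exists_isMinOn
    ⟨γ₀, hγ₀, le_refl (γ₀ᴴ * γ₀).trace.re⟩ hcont.continuousOn
  refine ⟨γ, hγ.1, fun γ' hγ' => ?_⟩
  rcases le_total (γ'ᴴ * γ').trace.re (γ₀ᴴ * γ₀).trace.re with h | h
  · exact hmin ⟨hγ', h⟩
  · exact le_trans hγ.2 h

/-- first-order condition for a norm-minimizing isomorphism -/
lemma re_trace_mul_eq_zero_of_min {w μ : Vn n} {γ B : Matrix (Fin n) (Fin n) ℂ}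
    (hγ : γ ∈ isoSet w μ) (hmin : ∀ γ' ∈ isoSet w μ, (γᴴ * γ).trace.re ≤ (γ'ᴴ * γ').trace.re)
    (hB : IsDeriv w B) (htr : B.trace = 0) : (γᴴ * γ * B).trace.re = 0 := by
  have hmem : ∀ t, γ * matExp B t ∈ isoSet w μ := fun t => by
    refine ⟨by rw [det_mul, hγ.1, det_matExp htr, one_mul], fun x y => ?_⟩
    have := congrArg (fun ω => mul ω (matExp B t *ᵥ x) (matExp B t *ᵥ y))
      (flow_eq_of_isDeriv hB t)
    simp only [flow, mul_tri, mulVec_mulVec, matExp_neg_mul, one_mulVec] at this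
    rw [← mulVec_mulVec, this, hγ.2, mulVec_mulVec, mulVec_mulVec]
  have hd : ∀ i j, HasDerivAt (fun t => (γ * matExp B t) i j) ((γ * B) i j) 0 := fun i j => by
    have : HasDerivAt (fun t => ∑ k, γ i k * matExp B t k j)
        (∑ k, γ i k * (matExp B 0 * B) k j) 0 :=
      HasDerivAt.fun_sum fun k _ => (hasDerivAt_matExp B 0 k j).const_mul _
    simp only [matExp_zero, one_mul] at this
    simpa only [mul_apply] using this
  have h := HasDerivAt.fun_sum (u := Finset.univ) fun j _ =>
    HasDerivAt.fun_sum (u := Finset.univ) fun i _ => hasDerivAt_normSq (hd i j)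
  have hloc : IsLocalMin (fun t => ∑ j, ∑ i, Complex.normSq ((γ * matExp B t) i j)) 0 :=
    Filter.Eventually.of_forall fun t => by
      simp only [← re_trace_conjTranspose_mul_self, matExp_zero, mul_one]
      exact hmin _ (hmem t)
  have h0 := hloc.hasDerivAt_eq_zero h
  simp only [matExp_zero, mul_one, ← Finset.mul_sum] at h0
  have h1 : (γᴴ * γ * B).trace = ∑ j, ∑ i, (γ * B) i j * star (γ i j) := by
    rw [mul_assoc, trace]
    refine Finset.sum_congr rfl fun j _ => ?_
    rw [diag_apply, mul_apply]
    exact Finset.sum_congr rfl fun i _ => by rw [conjTranspose_apply, mul_comm]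
  rw [h1]
  simp only [Complex.re_sum]
  linarith

lemma mem_slOrbit_of_isoSet {w μ : Vn n} {γ : Matrix (Fin n) (Fin n) ℂ} (h : γ ∈ isoSet w μ) :
    w ∈ slOrbit μ :=
  slOrbit_symm (mem_slOrbit_of_det γ h.1 h.2)

open scoped ComplexOrder in
lemma exists_polar {γ : Matrix (Fin n) (Fin n) ℂ} (hγ : γ.det = 1) :
    ∃ (V : Matrix (Fin n) (Fin n) ℂ) (a : Fin n → ℝ), Vᴴ * V = 1 ∧ ∑ i, a i = 0 ∧
      γᴴ * γ = V * diagonal (fun i => (Real.exp (2 * a i) : ℂ)) * Vᴴ := by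
  have hu : IsUnit γ := (Matrix.isUnit_iff_isUnit_det _).mpr (by rw [hγ]; exact isUnit_one)
  have hpd : (γᴴ * γ).PosDef := Matrix.PosDef.conjTranspose_mul_self γ
    (Matrix.mulVec_injective_of_isUnit hu)
  have hpos := hpd.eigenvalues_pos
  have hexp : ∀ i, Real.exp (2 * (Real.log (hpd.1.eigenvalues i) / 2)) = hpd.1.eigenvalues i :=
    fun i => by rw [mul_div_cancel₀ _ two_ne_zero, Real.exp_log (hpos i)]
  refine ⟨hpd.1.eigenvectorUnitary, fun i => Real.log (hpd.1.eigenvalues i) / 2,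
    Matrix.UnitaryGroup.star_mul_self _, ?_, ?_⟩
  · have h1 : (γᴴ * γ).det = 1 := by rw [det_mul, det_conjTranspose, hγ]; simp
    rw [hpd.1.det_eq_prod_eigenvalues] at h1
    have h2 : ∏ i, hpd.1.eigenvalues i = 1 := Complex.ofReal_injective (by
      rw [Complex.ofReal_prod, Complex.ofReal_one]; exact h1)
    rw [← Finset.sum_div, ← Real.log_prod fun i _ => (hpos i).ne', h2, Real.log_one, zero_div]
  · simp only [hexp]
    conv_lhs => rw [hpd.1.spectral_theorem]
    rfl

open Filter Topology

lemma tendsto_mul_sub_atTop {α f : ℕ → ℝ} {x : ℝ} (hα : Tendsto α atTop atTop)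
    (hf : Tendsto (fun k => (α k)⁻¹ * f k) atTop (𝓝 x)) (hx : 0 < x) : Tendsto f atTop atTop := by
  refine (hα.atTop_mul_pos hx hf).congr' ?_
  filter_upwards [hα.eventually_gt_atTop 0] with k hk
  rw [← mul_assoc, mul_inv_cancel₀ hk.ne', one_mul]

lemma eventually_sum_exp_mul_pos {a c : ℕ → Fin n → ℝ} {α : ℕ → ℝ} {b : Fin n → ℝ}
    (hα : Tendsto α atTop atTop) (ha : Tendsto (fun k => (α k)⁻¹ • a k) atTop (𝓝 b))
    (hc : Tendsto c atTop (𝓝 b)) (hb : ∃ i, 0 < b i) :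
    ∀ᶠ k in atTop, 0 < ∑ i, Real.exp (2 * a k i) * c k i := by
  obtain ⟨i₁, hi₁⟩ := hb
  obtain ⟨i₀, -, hi₀⟩ := Finset.exists_max_image Finset.univ b ⟨i₁, Finset.mem_univ _⟩
  have hm : 0 < b i₀ := hi₁.trans_le (hi₀ i₁ (Finset.mem_univ _))
  set t : ℕ → Fin n → ℝ := fun k i => Real.exp (2 * a k i - α k * b i₀) * c k i with ht
  have hai : ∀ i, Tendsto (fun k => (α k)⁻¹ * a k i) atTop (𝓝 (b i)) := fun i =>
    (tendsto_pi_nhds.mp ha) i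
  have hci : ∀ i, Tendsto (fun k => c k i) atTop (𝓝 (b i)) := tendsto_pi_nhds.mp hc
  have hαα : Tendsto (fun k => (α k)⁻¹ * α k) atTop (𝓝 1) := by
    refine tendsto_const_nhds.congr' ?_
    filter_upwards [hα.eventually_gt_atTop 0] with k hk
    rw [inv_mul_cancel₀ hk.ne']
  have hexp : ∀ i, Tendsto (fun k => (α k)⁻¹ * (2 * a k i - α k * b i₀)) atTop
      (𝓝 (2 * b i - 1 * b i₀)) := fun i => by
    refine (((hai i).const_mul 2).sub (hαα.mul_const (b i₀))).congr fun k => ?_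
    ring
  have htop : Tendsto (fun k => t k i₀) atTop atTop := by
    have := tendsto_mul_sub_atTop hα (hexp i₀) (by linarith)
    exact (Real.tendsto_exp_atTop.comp this).atTop_mul_pos hm (hci i₀)
  have hlow : ∀ i, ∀ᶠ k in atTop, -1 < t k i := fun i => by
    rcases lt_or_ge 0 (b i) with hi | hi
    · filter_upwards [(hci i).eventually_const_lt hi] with k hk
      have : 0 < t k i := mul_pos (Real.exp_pos _) hk
      linarith
    · have h1 : Tendsto (fun k => -(2 * a k i - α k * b i₀)) atTop atTop := by
        refine tendsto_mul_sub_atTop (x := -(2 * b i - 1 * b i₀)) hα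
          ((hexp i).neg.congr fun k => by ring) (by linarith)
      have h2 := (Real.tendsto_exp_atBot.comp (tendsto_neg_atTop_iff.mp h1)).mul (hci i)
      rw [zero_mul] at h2
      exact h2.eventually_const_lt (by norm_num)
  filter_upwards [eventually_all.mpr hlow, htop.eventually_gt_atTop (n : ℝ)] with k hk1 hk2
  have hsum : ∑ i, Real.exp (2 * a k i) * c k i = Real.exp (α k * b i₀) * ∑ i, t k i := by
    rw [Finset.mul_sum]
    refine Finset.sum_congr rfl fun i _ => ?_
    rw [ht, ← mul_assoc, ← Real.exp_add, add_sub_cancel]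
  rw [hsum]
  refine mul_pos (Real.exp_pos _) ?_
  rw [← Finset.add_sum_erase _ _ (Finset.mem_univ i₀)]
  have h1 : ∑ _i ∈ Finset.univ.erase i₀, (-1 : ℝ) ≤ ∑ i ∈ Finset.univ.erase i₀, t k i :=
    Finset.sum_le_sum fun i _ => (hk1 i).le
  rw [Finset.sum_const, nsmul_eq_mul, Finset.card_erase_of_mem (Finset.mem_univ _),
    Finset.card_univ, Fintype.card_fin] at h1
  have h2 : ((n - 1 : ℕ) : ℝ) ≤ n := by exact_mod_cast Nat.sub_le n 1
  linarith

lemma tri_diagonal (d e f : Fin n → ℂ) (μ : Vn n) (i j k : Fin n) :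
    tri (diagonal d) (diagonal e) (diagonal f) μ i j k = d k * e i * f j * μ i j k := by
  simp [tri_apply, diagonal_apply]

lemma glAct_diagonal (b : Fin n → ℂ) (μ : Vn n) (i j k : Fin n) :
    glAct (diagonal b) μ i j k = (b k - b i - b j) * μ i j k := by
  simp only [glAct_eq_tri, ← diagonal_one, Pi.sub_apply, tri_diagonal]
  ring

lemma tri_mul_mul_left {V V' : Matrix (Fin n) (Fin n) ℂ} (X Y Z : Matrix (Fin n) (Fin n) ℂ)
    (ω : Vn n) :
    tri (V * X * V') (V * Y * V') (V * Z * V') ω = tri V V' V' (tri X Y Z (tri V' V V ω)) := by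
  simp only [tri_tri, mul_assoc]

lemma glAct_conj {V : Matrix (Fin n) (Fin n) ℂ} (hV : Vᴴ * V = 1) (D : Matrix (Fin n) (Fin n) ℂ)
    (ω : Vn n) : glAct (V * D * Vᴴ) ω = tri V Vᴴ Vᴴ (glAct D (tri Vᴴ V V ω)) := by
  have h1 : (1 : Matrix (Fin n) (Fin n) ℂ) = V * 1 * Vᴴ := by
    rw [mul_one, mul_eq_one_comm.mp hV]
  conv_lhs => rw [glAct_eq_tri, h1]
  simp only [tri_mul_mul_left, glAct_eq_tri, tri_sub]

/-- the norm of an algebra in terms of the polar decomposition of an isomorphism -/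
lemma normSqV_eq_sum {w μ : Vn n} {γ V : Matrix (Fin n) (Fin n) ℂ} {a : Fin n → ℝ}
    (hγ : γ ∈ isoSet w μ) (hV : Vᴴ * V = 1)
    (h : γᴴ * γ = V * diagonal (fun i => (Real.exp (2 * a i) : ℂ)) * Vᴴ) :
    normSqV μ = ∑ i, ∑ j, ∑ k, Real.exp (2 * (a k - a i - a j)) *
      Complex.normSq (tri Vᴴ V V w i j k) := by
  have hV' : V * Vᴴ = 1 := mul_eq_one_comm.mp hV
  have hinv : γ * γ⁻¹ = 1 := Matrix.mul_nonsing_inv γ (by rw [hγ.1]; exact isUnit_one)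
  have hμ : μ = tri γ γ⁻¹ γ⁻¹ w := by
    refine ext_mul fun x y => ?_
    rw [mul_tri, hγ.2, mulVec_mulVec, mulVec_mulVec, hinv, one_mulVec, one_mulVec]
  have hD : diagonal (fun i => (Real.exp (2 * a i) : ℂ)) *
      diagonal (fun i => (Real.exp (-(2 * a i)) : ℂ)) = 1 := by
    rw [diagonal_mul_diagonal, ← diagonal_one]
    congr 1
    ext i
    rw [← Complex.ofReal_mul, ← Real.exp_add, add_neg_cancel, Real.exp_zero, Complex.ofReal_one]
  have hinv2 : γ⁻¹ * γ⁻¹ᴴ = V * diagonal (fun i => (Real.exp (-(2 * a i)) : ℂ)) * Vᴴ := by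
    have h1 : γᴴ * γ * (γ⁻¹ * γ⁻¹ᴴ) = 1 := by
      rw [mul_assoc, ← mul_assoc γ, hinv, one_mul, ← conjTranspose_mul, mul_eq_one_comm.mp hinv,
        conjTranspose_one]
    have h2 : γᴴ * γ * (V * diagonal (fun i => (Real.exp (-(2 * a i)) : ℂ)) * Vᴴ) = 1 := by
      rw [h]
      simp only [mul_assoc]
      rw [← mul_assoc Vᴴ V, hV, one_mul, ← mul_assoc (diagonal _) (diagonal _), hD, one_mul, hV']
    exact left_inv_eq_right_inv (mul_eq_one_comm.mp h1) h2
  have h1 : innerV μ μ = innerV (tri Vᴴ V V w)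
      (tri (diagonal fun i => (Real.exp (2 * a i) : ℂ))
        (diagonal fun i => (Real.exp (-(2 * a i)) : ℂ))
        (diagonal fun i => (Real.exp (-(2 * a i)) : ℂ)) (tri Vᴴ V V w)) := by
    conv_lhs => rw [hμ]
    rw [innerV_tri, tri_tri, hinv2, h, tri_mul_mul_left, innerV_tri, conjTranspose_conjTranspose]
  rw [innerV_self] at h1
  apply Complex.ofReal_injective
  rw [h1]
  simp only [innerV, tri_diagonal, Complex.ofReal_sum]
  refine Finset.sum_congr rfl fun i _ => Finset.sum_congr rfl fun j _ =>
    Finset.sum_congr rfl fun k _ => ?_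
  rw [show 2 * (a k - a i - a j) = 2 * a k + -(2 * a i) + -(2 * a j) by ring, Real.exp_add,
    Real.exp_add]
  simp only [Complex.ofReal_mul, ← Complex.mul_conj, star_mul', Complex.star_def,
    Complex.conj_ofReal]
  ring

lemma eq_zero_of_weight_pos {u : ℕ → Vn n} {u₀ : Vn n} {a : ℕ → Fin n → ℝ} {α : ℕ → ℝ}
    {b : Fin n → ℝ} {C : ℝ} (hα : Tendsto α atTop atTop)
    (ha : Tendsto (fun k => (α k)⁻¹ • a k) atTop (𝓝 b)) (hu : Tendsto u atTop (𝓝 u₀))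
    (hC : ∀ k, ∑ i, ∑ j, ∑ l, Real.exp (2 * (a k l - a k i - a k j)) *
      Complex.normSq (u k i j l) ≤ C)
    {i j l : Fin n} (hw : 0 < b l - b i - b j) : u₀ i j l = 0 := by
  have hai : ∀ i, Tendsto (fun k => (α k)⁻¹ * a k i) atTop (𝓝 (b i)) := fun i =>
    (tendsto_pi_nhds.mp ha) i
  have hexp : Tendsto (fun k => 2 * (a k l - a k i - a k j)) atTop atTop := by
    refine tendsto_mul_sub_atTop (x := 2 * (b l - b i - b j)) hα ?_ (by linarith)
    exact ((((hai l).sub (hai i)).sub (hai j)).const_mul 2).congr fun k => by ring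
  have hle : ∀ k, Complex.normSq (u k i j l) ≤
      C * Real.exp (-(2 * (a k l - a k i - a k j))) := fun k => by
    have hnn : ∀ i j l, 0 ≤ Real.exp (2 * (a k l - a k i - a k j)) *
        Complex.normSq (u k i j l) := fun i j l =>
      mul_nonneg (Real.exp_pos _).le (Complex.normSq_nonneg _)
    have h1 := Finset.single_le_sum (f := fun l => Real.exp (2 * (a k l - a k i - a k j)) *
      Complex.normSq (u k i j l)) (fun l _ => hnn i j l) (Finset.mem_univ l)
    have h2 := Finset.single_le_sum (f := fun j => ∑ l, Real.exp (2 * (a k l - a k i - a k j)) *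
      Complex.normSq (u k i j l)) (fun j _ => Finset.sum_nonneg fun l _ => hnn i j l)
      (Finset.mem_univ j)
    have h3 := Finset.single_le_sum (f := fun i => ∑ j, ∑ l,
      Real.exp (2 * (a k l - a k i - a k j)) * Complex.normSq (u k i j l))
      (fun i _ => Finset.sum_nonneg fun j _ => Finset.sum_nonneg fun l _ => hnn i j l)
      (Finset.mem_univ i)
    have h4 := (h1.trans (h2.trans h3)).trans (hC k)
    rw [Real.exp_neg, ← div_eq_mul_inv, le_div_iff₀ (Real.exp_pos _), mul_comm]
    exact h4
  have h0 : Tendsto (fun k => C * Real.exp (-(2 * (a k l - a k i - a k j)))) atTop (𝓝 0) := by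
    have := (Real.tendsto_exp_neg_atTop_nhds_zero.comp hexp).const_mul C
    rwa [mul_zero] at this
  have h1 : Tendsto (fun k => Complex.normSq (u k i j l)) atTop (𝓝 (Complex.normSq (u₀ i j l))) :=
    (Complex.continuous_normSq.tendsto _).comp
      (tendsto_pi_nhds.mp (tendsto_pi_nhds.mp (tendsto_pi_nhds.mp hu i) j) l)
  exact Complex.normSq_eq_zero.mp (le_antisymm (le_of_tendsto_of_tendsto' h1 h0 hle)
    (Complex.normSq_nonneg _))

/-- a diagonalizable direction along which a critical algebra has only nonpositive weights is a
derivation -/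
lemma IsCritical.isDeriv_of_weights {ν : Vn n} (h : IsCritical ν) {V : Matrix (Fin n) (Fin n) ℂ}
    (hV : Vᴴ * V = 1) {b : Fin n → ℝ} (hb : ∑ i, b i = 0)
    (hw : ∀ i j k, 0 < b k - b i - b j → tri Vᴴ V V ν i j k = 0) :
    IsDeriv ν (V * diagonal (fun i => (b i : ℂ)) * Vᴴ) := by
  have htr : (V * diagonal (fun i => (b i : ℂ)) * Vᴴ).trace = 0 := by
    rw [trace_mul_comm, ← mul_assoc, hV, one_mul, trace_diagonal, ← Complex.ofReal_sum, hb,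
      Complex.ofReal_zero]
  have h1 := h _ htr
  rw [glAct_conj hV, innerV_tri, conjTranspose_conjTranspose] at h1
  set u := tri Vᴴ V V ν with hu
  have h2 : (innerV (glAct (diagonal fun i => (b i : ℂ)) u) u).re =
      ∑ i, ∑ j, ∑ k, (b k - b i - b j) * Complex.normSq (u i j k) := by
    simp only [innerV, glAct_diagonal, Complex.re_sum]
    refine Finset.sum_congr rfl fun i _ => Finset.sum_congr rfl fun j _ =>
      Finset.sum_congr rfl fun k _ => ?_
    rw [Complex.star_def, mul_assoc, Complex.mul_conj, ← Complex.ofReal_sub, ← Complex.ofReal_sub,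
      ← Complex.ofReal_mul, Complex.ofReal_re]
  have hle : ∀ i j k, (b k - b i - b j) * Complex.normSq (u i j k) ≤ 0 := fun i j k => by
    rcases lt_or_ge 0 (b k - b i - b j) with h | h
    · rw [hw i j k h, map_zero, mul_zero]
    · exact mul_nonpos_of_nonpos_of_nonneg h (Complex.normSq_nonneg _)
  rw [h2] at h1
  have hzero : ∀ i j k, (b k - b i - b j) * Complex.normSq (u i j k) = 0 := fun i j k => by
    have a1 := (Finset.sum_eq_zero_iff_of_nonpos fun i _ => Finset.sum_nonpos fun j _ =>
      Finset.sum_nonpos fun k _ => hle i j k).mp h1 i (Finset.mem_univ i)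
    have a2 := (Finset.sum_eq_zero_iff_of_nonpos fun j _ =>
      Finset.sum_nonpos fun k _ => hle i j k).mp a1 j (Finset.mem_univ j)
    exact (Finset.sum_eq_zero_iff_of_nonpos fun k _ => hle i j k).mp a2 k (Finset.mem_univ k)
  have hgl : glAct (diagonal fun i => (b i : ℂ)) u = 0 := by
    ext i j k
    rw [glAct_diagonal, ← Complex.ofReal_sub, ← Complex.ofReal_sub]
    rcases mul_eq_zero.mp (hzero i j k) with h | h
    · simp [h]
    · simp [Complex.normSq_eq_zero.mp h]
  rw [← glAct_eq_zero_iff, glAct_conj hV, ← hu, hgl, tri_zero]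

/-- inner derivations deform along with the Jordan algebra -/
lemma exists_tendsto_of_mem_innSub {w : ℕ → Vn n} {ν : Vn n} (hw : ∀ k, IsJordan (w k))
    (hν : Tendsto w atTop (𝓝 ν)) {A : Matrix (Fin n) (Fin n) ℂ} (hA : A ∈ innSub ν) :
    ∃ B : ℕ → Matrix (Fin n) (Fin n) ℂ, (∀ k, IsDeriv (w k) (B k)) ∧ (∀ k, (B k).trace = 0) ∧
      Tendsto B atTop (𝓝 A) := by
  have hzero : ∀ μ : Vn n, IsDeriv μ 0 := fun μ => (derSub μ).zero_mem
  have hadd : ∀ {μ : Vn n} {X Y}, IsDeriv μ X → IsDeriv μ Y → IsDeriv μ (X + Y) :=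
    fun {μ _ _} hX hY => (derSub μ).add_mem hX hY
  have hsmul : ∀ {μ : Vn n} (c : ℂ) {X}, IsDeriv μ X → IsDeriv μ (c • X) :=
    fun {μ} c _ hX => (derSub μ).smul_mem c hX
  induction hA using Submodule.span_induction with
  | mem x hx =>
    obtain ⟨p, rfl⟩ := hx
    refine ⟨fun k => comm (w k) p.1 p.2, fun k => (hw k).isDeriv_comm _ _, fun k => ?_, ?_⟩
    · simp only [comm, trace_sub]
      rw [trace_mul_comm, sub_self]
    · have hc : Continuous fun μ : Vn n => comm μ p.1 p.2 := by
        have hL : ∀ x : Fin n → ℂ, Continuous fun μ : Vn n => L μ x := fun x =>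
          continuous_L.comp (continuous_id.prodMk continuous_const)
        exact ((hL _).matrix_mul (hL _)).sub ((hL _).matrix_mul (hL _))
      exact (hc.tendsto ν).comp hν
  | zero => exact ⟨fun _ => 0, fun k => hzero _, fun _ => trace_zero _ _, tendsto_const_nhds⟩
  | add x y _ _ hx hy =>
    obtain ⟨B, hB, hBt, hBl⟩ := hx
    obtain ⟨B', hB', hBt', hBl'⟩ := hy
    exact ⟨fun k => B k + B' k, fun k => hadd (hB k) (hB' k),
      fun k => by rw [trace_add, hBt, hBt', add_zero], hBl.add hBl'⟩
  | smul c x _ hx =>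
    obtain ⟨B, hB, hBt, hBl⟩ := hx
    exact ⟨fun k => c • B k, fun k => hsmul c (hB k),
      fun k => by rw [trace_smul, hBt, smul_zero], hBl.const_smul c⟩

instance : FirstCountableTopology (Matrix (Fin n) (Fin n) ℂ) :=
  inferInstanceAs (FirstCountableTopology (Fin n → Fin n → ℂ))

lemma isCompact_unitary :
    IsCompact {V : Matrix (Fin n) (Fin n) ℂ | Vᴴ * V = 1} := by
  refine (isCompact_re_trace_le (n := n) n).of_isClosed_subset
    (isClosed_eq (continuous_id.matrix_conjTranspose.matrix_mul continuous_id) continuous_const) ?_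
  intro V hV
  have hV : Vᴴ * V = 1 := hV
  simp [hV]

lemma tendsto_tri {X Y Z : ℕ → Matrix (Fin n) (Fin n) ℂ} {w : ℕ → Vn n}
    {X₀ Y₀ Z₀ : Matrix (Fin n) (Fin n) ℂ} {ν : Vn n} (hX : Tendsto X atTop (𝓝 X₀))
    (hY : Tendsto Y atTop (𝓝 Y₀)) (hZ : Tendsto Z atTop (𝓝 Z₀)) (hw : Tendsto w atTop (𝓝 ν)) :
    Tendsto (fun k => tri (X k) (Y k) (Z k) (w k)) atTop (𝓝 (tri X₀ Y₀ Z₀ ν)) := by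
  have e : ∀ {M : ℕ → Matrix (Fin n) (Fin n) ℂ} {M₀}, Tendsto M atTop (𝓝 M₀) → ∀ i j,
      Tendsto (fun k => M k i j) atTop (𝓝 (M₀ i j)) := fun h i j =>
    tendsto_pi_nhds.mp (tendsto_pi_nhds.mp h i) j
  refine tendsto_pi_nhds.mpr fun i => tendsto_pi_nhds.mpr fun j => tendsto_pi_nhds.mpr fun l => ?_
  simp only [tri_apply]
  exact tendsto_finsetSum _ fun c _ => tendsto_finsetSum _ fun a _ => tendsto_finsetSum _ fun b _ =>
    (((e hX l c).mul (e hY a i)).mul (e hZ b j)).mul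
      (tendsto_pi_nhds.mp (tendsto_pi_nhds.mp (tendsto_pi_nhds.mp hw a) b) c)

lemma exists_pos_of_sum_eq_zero {b : Fin n → ℝ} (hb : ∑ i, b i = 0) (h0 : b ≠ 0) :
    ∃ i, 0 < b i := by
  by_contra! h
  exact h0 (funext fun i => (Finset.sum_eq_zero_iff_of_nonpos fun i _ => h i).mp hb i
    (Finset.mem_univ i))

/-- norm-minimizing isomorphisms from algebras converging to a critical semisimple Jordan algebra
do not diverge -/
lemma not_tendsto_norm_atTop {w : ℕ → Vn n} {μ ν : Vn n} {γ V : ℕ → Matrix (Fin n) (Fin n) ℂ}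
    {a : ℕ → Fin n → ℝ} (hw : ∀ k, IsJordan (w k)) (hν : Tendsto w atTop (𝓝 ν))
    (hJ : IsJordan ν) (hτ : TraceFormNondeg ν) (hcrit : IsCritical ν)
    (hγ : ∀ k, γ k ∈ isoSet (w k) μ)
    (hmin : ∀ k, ∀ γ' ∈ isoSet (w k) μ, ((γ k)ᴴ * γ k).trace.re ≤ (γ'ᴴ * γ').trace.re)
    (hV : ∀ k, (V k)ᴴ * V k = 1) (ha : ∀ k, ∑ i, a k i = 0)
    (hp : ∀ k, (γ k)ᴴ * γ k =
      V k * diagonal (fun i => (Real.exp (2 * a k i) : ℂ)) * (V k)ᴴ) :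
    ¬ Tendsto (fun k => ‖a k‖) atTop atTop := by
  intro hα
  have hK := (isCompact_unitary (n := n)).prod (isCompact_closedBall (0 : Fin n → ℝ) 1)
  obtain ⟨⟨U, b⟩, hUb, φ, hφ, hlim⟩ := hK.tendsto_subseq
    (x := fun k => (V k, ‖a k‖⁻¹ • a k)) fun k => by
      refine ⟨hV k, ?_⟩
      rw [mem_closedBall_zero_iff, norm_smul, norm_inv, norm_norm]
      exact inv_mul_le_one
  have hU : Uᴴ * U = 1 := hUb.1
  have hα' : Tendsto (fun k => ‖a (φ k)‖) atTop atTop := hα.comp hφ.tendsto_atTop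
  have hν' : Tendsto (fun k => w (φ k)) atTop (𝓝 ν) := hν.comp hφ.tendsto_atTop
  have hVl : Tendsto (fun k => V (φ k)) atTop (𝓝 U) := (continuous_fst.tendsto _).comp hlim
  have hbl : Tendsto (fun k => ‖a (φ k)‖⁻¹ • a (φ k)) atTop (𝓝 b) :=
    (continuous_snd.tendsto _).comp hlim
  have hbsum : ∑ i, b i = 0 := by
    have h1 : Tendsto (fun k => ∑ i, (‖a (φ k)‖⁻¹ • a (φ k)) i) atTop (𝓝 (∑ i, b i)) :=
      tendsto_finsetSum _ fun i _ => tendsto_pi_nhds.mp hbl i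
    refine tendsto_nhds_unique h1 (tendsto_const_nhds.congr fun k => ?_)
    simp only [Pi.smul_apply, smul_eq_mul]
    rw [← Finset.mul_sum, ha, mul_zero]
  have hbn : ‖b‖ = 1 := by
    refine tendsto_nhds_unique hbl.norm (tendsto_const_nhds.congr' ?_)
    filter_upwards [hα'.eventually_gt_atTop 0] with k hk
    rw [norm_smul, norm_inv, norm_norm, inv_mul_cancel₀ hk.ne']
  have hb0 : b ≠ 0 := by
    rintro rfl
    simp at hbn
  have hVh : Tendsto (fun k => (V (φ k))ᴴ) atTop (𝓝 Uᴴ) :=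
    (continuous_id.matrix_conjTranspose.tendsto U).comp hVl
  have hu : Tendsto (fun k => tri (V (φ k))ᴴ (V (φ k)) (V (φ k)) (w (φ k))) atTop
      (𝓝 (tri Uᴴ U U ν)) := tendsto_tri hVh hVl hVl hν'
  have hA : IsDeriv ν (U * diagonal (fun i => (b i : ℂ)) * Uᴴ) :=
    hcrit.isDeriv_of_weights hU hbsum fun i j l hl =>
      eq_zero_of_weight_pos hα' hbl hu
        (fun k => (normSqV_eq_sum (hγ (φ k)) (hV (φ k)) (hp (φ k))).ge) hl
  have hA' : U * diagonal (fun i => (b i : ℂ)) * Uᴴ ∈ innSub ν := by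
    rw [hJ.derSub_eq_innSub hτ]
    exact hA
  obtain ⟨B, hB, hBt, hBl⟩ := exists_tendsto_of_mem_innSub (fun k => hw (φ k)) hν' hA'
  have hc : Tendsto (fun k => (V (φ k))ᴴ * B k * V (φ k)) atTop
      (𝓝 (diagonal fun i => (b i : ℂ))) := by
    have h1 : Continuous fun p : Matrix (Fin n) (Fin n) ℂ × Matrix (Fin n) (Fin n) ℂ ×
        Matrix (Fin n) (Fin n) ℂ => p.1 * p.2.1 * p.2.2 :=
      (continuous_fst.matrix_mul (continuous_fst.comp continuous_snd)).matrix_mul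
        (continuous_snd.comp continuous_snd)
    have h2 : Tendsto (fun k => ((V (φ k))ᴴ, B k, V (φ k))) atTop
        (𝓝 (Uᴴ, U * diagonal (fun i => (b i : ℂ)) * Uᴴ, U)) :=
      hVh.prodMk_nhds (hBl.prodMk_nhds hVl)
    have h3 : Uᴴ * (U * diagonal (fun i => (b i : ℂ)) * Uᴴ) * U =
        diagonal fun i => (b i : ℂ) := by
      rw [mul_assoc, mul_assoc, hU, mul_one, ← mul_assoc, hU, one_mul]
    have h4 := (h1.tendsto _).comp h2
    simp only [h3] at h4
    exact h4
  have hcr : Tendsto (fun k i => (((V (φ k))ᴴ * B k * V (φ k)) i i).re) atTop (𝓝 b) :=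
    tendsto_pi_nhds.mpr fun i => by
      have h1 := tendsto_pi_nhds.mp (tendsto_pi_nhds.mp hc i) i
      have h2 := (Complex.continuous_re.tendsto _).comp h1
      rw [diagonal_apply_eq, Complex.ofReal_re] at h2
      exact h2
  obtain ⟨k, hk⟩ :=
    (eventually_sum_exp_mul_pos hα' hbl hcr (exists_pos_of_sum_eq_zero hbsum hb0)).exists
  have hz := re_trace_mul_eq_zero_of_min (hγ (φ k)) (hmin (φ k)) (hB k) (hBt k)
  rw [hp, mul_assoc, mul_assoc, trace_mul_comm, mul_assoc, trace, Complex.re_sum] at hz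
  refine hk.ne' (Eq.trans (Finset.sum_congr rfl fun i _ => ?_) hz)
  rw [diag_apply, diagonal_mul, Complex.re_ofReal_mul]

/-- a critical semisimple Jordan algebra lies in every orbit whose closure contains it -/
lemma IsCritical.mem_slOrbit {μ ν : Vn n} (hcrit : IsCritical ν) (hμ : IsJordan μ)
    (hτ : TraceFormNondeg ν) (h : ν ∈ closure (slOrbit μ)) : ν ∈ slOrbit μ := by
  obtain ⟨w, hw, hν⟩ := mem_closure_iff_seq_limit.mp h
  choose γ hγ hmin using fun k => exists_min_isoSet (hw k)
  choose V a hV ha hp using fun k => exists_polar (hγ k).1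
  have hnot := not_tendsto_norm_atTop
    (fun k => hμ.of_mem_closure (subset_closure (hw k))) hν (hμ.of_mem_closure h) hτ hcrit
    hγ hmin hV ha hp
  rw [tendsto_atTop] at hnot
  push Not at hnot
  obtain ⟨C, hC⟩ := hnot
  have hle : ∀ k, ‖a k‖ < C → ((γ k)ᴴ * γ k).trace.re ≤ ∑ _i : Fin n, Real.exp (2 * C) :=
    fun k hk => by
      rw [hp, trace_mul_comm, ← mul_assoc, hV, one_mul, trace_diagonal, Complex.re_sum]
      refine Finset.sum_le_sum fun i _ => ?_
      rw [Complex.ofReal_re, Real.exp_le_exp]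
      have := (le_abs_self _).trans (norm_le_pi_norm (a k) i)
      linarith
  obtain ⟨Γ, -, φ, hφ, hlim⟩ := (isCompact_re_trace_le (n := n)
    (∑ _i : Fin n, Real.exp (2 * C))).tendsto_subseq' (x := γ) (hC.mono fun k hk => hle k hk)
  have hν' : Tendsto (fun k => w (φ k)) atTop (𝓝 ν) := hν.comp hφ.tendsto_atTop
  have hpair : Tendsto (fun k => (w (φ k), γ (φ k))) atTop (𝓝 (ν, Γ)) := hν'.prodMk_nhds hlim
  have hΓ : Γ ∈ isoSet ν μ :=
    (isClosed_isoSet_prod μ).mem_of_tendsto hpair (Eventually.of_forall fun k => hγ (φ k))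
  exact mem_slOrbit_of_isoSet hΓ

lemma IsJordan.isClosed_slOrbit {μ : Vn n} (hJ : IsJordan μ) (hτ : TraceFormNondeg μ) :
    IsClosed (slOrbit μ) := by
  refine isClosed_of_closure_subset fun ω hω => ?_
  obtain ⟨ν, hν, hcrit⟩ := exists_isCritical ω
  have hνμ := closure_slOrbit_subset hω hν
  have hτν := (traceFormNondeg_iff_of_mem_closure hνμ).mpr hτ
  exact slOrbit_trans (hcrit.mem_slOrbit hJ hτν hνμ)
    (slOrbit_symm (hcrit.mem_slOrbit (hJ.of_mem_closure hω) hτν hν))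

lemma IsJordan.zero_mem_closure {μ : Vn n} (hJ : IsJordan μ) (hτ : ¬ TraceFormNondeg μ) :
    (0 : Vn n) ∈ closure (slOrbit μ) := by
  obtain ⟨ν, hν, hcrit⟩ := exists_isCritical μ
  rcases eq_or_ne ν 0 with rfl | h0
  · exact hν
  · exact absurd ((traceFormNondeg_iff_of_mem_closure hν).mp
      (hcrit.traceFormNondeg (hJ.of_mem_closure hν) h0)) hτ

lemma eq_zero_of_zero_mem_slOrbit {μ : Vn n} (h : (0 : Vn n) ∈ slOrbit μ) : μ = 0 := by
  obtain ⟨g, hg⟩ := slOrbit_symm h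
  rw [hg, slAct_zero]

end Vn

/-- for nonzero `μ ∈ 𝒥_n`: (a) the orbit `SL(n,ℂ)·μ` is closed iff the trace
form `τ_μ` is nondegenerate (`μ` is semisimple); (b) if `τ_μ` is degenerate then `0` lies
in the closure of `SL(n,ℂ)·μ`. -/
theorem stmt16 {n : ℕ} (μ : Vn n) (hJ : Vn.IsJordan μ) (h0 : μ ≠ 0) :
    (IsClosed (slOrbit μ) ↔ Vn.TraceFormNondeg μ) ∧
    (¬ Vn.TraceFormNondeg μ → (0 : Vn n) ∈ closure (slOrbit μ)) := by
  refine ⟨⟨fun h => ?_, hJ.isClosed_slOrbit⟩, hJ.zero_mem_closure⟩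
  by_contra hτ
  have h1 := hJ.zero_mem_closure hτ
  rw [h.closure_eq] at h1
  exact h0 (Vn.eq_zero_of_zero_mem_slOrbit h1)
end
end

section
/- Let μ ∈ 𝒥_n be a soliton, and let x, y ∈ ℂⁿ be eigenvectors of D_μ := M_μ − c_μ·I (with c_μ := −Tr(M_μ²)/‖μ‖²) with corresponding real eigenvalues d_x ≠ d_y. Then Tr(L^μ_x (L^μ_y)*) = 0, i.e., the left multiplications L^μ_x and L^μ_y are orthogonal. -/
open Matrix

noncomputable section

namespace Vn

lemma glAct_apply {n : ℕ} (A : Matrix (Fin n) (Fin n) ℂ) (μ : Vn n) (i j k : Fin n) :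
    glAct A μ i j k = ∑ l, A k l * μ i j l - ∑ l, A l i * μ l j k - ∑ l, A l j * μ i l k := by
  simp [glAct, mul, Matrix.mulVec, dotProduct, Pi.single_apply]

/-- Averaging the infinitesimal action over `x` expresses it through left multiplications. -/
lemma L_glAct {n : ℕ} (A : Matrix (Fin n) (Fin n) ℂ) (μ : Vn n) (x : Fin n → ℂ) :
    L (glAct A μ) x = A * L μ x - L μ (A *ᵥ x) - L μ x * A := by
  ext k j
  simp only [L, Matrix.of_apply, Matrix.sub_apply, Matrix.mul_apply, glAct_apply, mul_sub,
    Finset.sum_sub_distrib, Matrix.mulVec, dotProduct, Finset.mul_sum, Finset.sum_mul]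
  congr 1
  · congr 1
    · rw [Finset.sum_comm]
      exact Finset.sum_congr rfl fun _ _ => Finset.sum_congr rfl fun _ _ => by ring
    · rw [Finset.sum_comm]
      exact Finset.sum_congr rfl fun _ _ => Finset.sum_congr rfl fun _ _ => by ring
  · rw [Finset.sum_comm]
    exact Finset.sum_congr rfl fun _ _ => Finset.sum_congr rfl fun _ _ => by ring

lemma L_smul_left {n : ℕ} (c : ℂ) (μ : Vn n) (x : Fin n → ℂ) : L (c • μ) x = c • L μ x := by
  ext k j
  simp [L, Finset.mul_sum, mul_left_comm]

lemma L_smul_right {n : ℕ} (c : ℂ) (μ : Vn n) (x : Fin n → ℂ) : L μ (c • x) = c • L μ x := by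
  ext k j
  simp [L, Finset.mul_sum, mul_assoc]

lemma Mmat_conjTranspose {n : ℕ} (μ : Vn n) : (Mmat μ)ᴴ = Mmat μ := by
  simp [Mmat, Matrix.conjTranspose_sum, Matrix.conjTranspose_smul]

/-- If `M_μ` acts on `μ` by the scalar `c`, then left multiplication by an eigenvector of `D_μ`
is an eigenvector of `ad M_μ`. -/
lemma Mmat_commutator_L {n : ℕ} {μ : Vn n} {c d : ℝ} (hc : glAct (Mmat μ) μ = (c : ℂ) • μ)
    {x : Fin n → ℂ} (hx : Dmat μ *ᵥ x = (d : ℂ) • x) :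
    Mmat μ * L μ x - L μ x * Mmat μ = ((d + cconst μ + c : ℝ) : ℂ) • L μ x := by
  have hM : Mmat μ *ᵥ x = ((d + cconst μ : ℝ) : ℂ) • x := by
    rw [Dmat, Matrix.sub_mulVec, Matrix.smul_mulVec, Matrix.one_mulVec, sub_eq_iff_eq_add] at hx
    rw [hx, ← add_smul, Complex.ofReal_add]
  have h := L_glAct (Mmat μ) μ x
  rw [hc, L_smul_left, hM, L_smul_right] at h
  rw [Complex.ofReal_add, add_smul, h]
  abel

end Vn

/-- if `μ ∈ 𝒥_n` is a soliton and `x, y` are eigenvectors of `D_μ` with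
distinct real eigenvalues, then `Tr(L^μ_x (L^μ_y)*) = 0`. -/
theorem stmt17 {n : ℕ} (μ : Vn n) (hJ : Vn.IsJordan μ) (hsol : Vn.IsSoliton μ)
    (x y : Fin n → ℂ) (hx0 : x ≠ 0) (hy0 : y ≠ 0) (dx dy : ℝ) (hne : dx ≠ dy)
    (hx : Vn.Dmat μ *ᵥ x = (dx : ℂ) • x) (hy : Vn.Dmat μ *ᵥ y = (dy : ℂ) • y) :
    Matrix.trace (Vn.L μ x * (Vn.L μ y)ᴴ) = 0 := by
  obtain ⟨-, c, hc⟩ := hsol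
  have hLx := Vn.Mmat_commutator_L hc hx
  have hLy := congrArg Matrix.conjTranspose (Vn.Mmat_commutator_L hc hy)
  rw [Matrix.conjTranspose_sub, Matrix.conjTranspose_mul, Matrix.conjTranspose_mul,
    Vn.Mmat_conjTranspose, Matrix.conjTranspose_smul, Complex.star_def,
    Complex.conj_ofReal] at hLy
  have h : Matrix.trace ((Vn.Mmat μ * Vn.L μ x - Vn.L μ x * Vn.Mmat μ) * (Vn.L μ y)ᴴ)
      = Matrix.trace (Vn.L μ x * ((Vn.L μ y)ᴴ * Vn.Mmat μ - Vn.Mmat μ * (Vn.L μ y)ᴴ)) := by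
    rw [Matrix.sub_mul, Matrix.mul_sub, Matrix.trace_sub, Matrix.trace_sub, Matrix.mul_assoc,
      Matrix.trace_mul_comm (Vn.Mmat μ), Matrix.mul_assoc, Matrix.mul_assoc]
  rw [hLx, hLy, Matrix.smul_mul, Matrix.mul_smul, Matrix.trace_smul, Matrix.trace_smul,
    smul_eq_mul, smul_eq_mul] at h
  by_contra h0
  exact hne (by linarith [Complex.ofReal_injective (mul_right_cancel₀ h0 h)])
end
end
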